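/- Fix an integer n ≥ 2. The following two assertions are equivalent. (A) For every ε > 0 and every H > 0 there exists N₀ such that for every integer N ≥ N₀ and every nonzero polynomial Q in n real variables of total degree at most N, there exists a unit vector v ∈ S^{n-1} that is NOT (N, ε, H)-singular with respect to Q. (B) For every δ > 0 and every ε > 0 there exists c > 0 such that for every positive integer N the following holds: if P ⊆ [0,1]^n is a union of closed cubes of the form ∏_{i=1}^n [k_i/N, (k_i+1)/N] (k ∈ ℤ^n, cubes contained in [0,1]^n) with the property that for every unit vector v ∈ S^{n-1} there exists a line l_v with direction v such that the one-dimensional Lebesgue measure of {t ∈ ℝ : x_v + t•v ∈ P} is at least δ (where l_v = {x_v + t•v : t ∈ ℝ}), then the Lebesgue measure of P is at least c·N^{-ε}. -/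

import Mathlib

open MeasureTheory ENNReal

/-- The closed grid cube of side `δ` indexed by `k ∈ ℤ^n`. -/
def gridCube (n : ℕ) (δ : ℝ) (k : Fin n → ℤ) : Set (EuclideanSpace ℝ (Fin n)) :=
  {x | ∀ i, x i ∈ Set.Icc ((k i : ℝ) * δ) (((k i : ℝ) + 1) * δ)}

/-- The unit cube `[0,1]^n`. -/
def unitCube (n : ℕ) : Set (EuclideanSpace ℝ (Fin n)) :=
  {x | ∀ i, x i ∈ Set.Icc (0 : ℝ) 1}

/-- A set `Δ` is roughly bisected by the polynomial `Q` if both `{Q > 0}` and `{Q < 0}`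
occupy at least a tenth of the volume of `Δ`. -/
def RoughlyBisected {n : ℕ} (Q : MvPolynomial (Fin n) ℝ)
    (Δ : Set (EuclideanSpace ℝ (Fin n))) : Prop :=
  (10 : ℝ≥0∞)⁻¹ * volume Δ ≤
      volume {x ∈ Δ | 0 < MvPolynomial.eval (fun i => x i) Q} ∧
  (10 : ℝ≥0∞)⁻¹ * volume Δ ≤
      volume {x ∈ Δ | MvPolynomial.eval (fun i => x i) Q < 0}

/-- A unit vector `v` is `(N, ε, H)`-singular with respect to `Q` if there is a line
with direction `v` such that at least `H⁻¹ · N^{1+ε}` of the `N^{-(1+ε)}`-grid cubes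
contained in `[0,1]^n` are roughly bisected by `Q` and intersect the line. -/
def IsSingularDir {n : ℕ} (N : ℕ) (ε H : ℝ) (Q : MvPolynomial (Fin n) ℝ)
    (v : EuclideanSpace ℝ (Fin n)) : Prop :=
  ∃ x : EuclideanSpace ℝ (Fin n),
    H⁻¹ * (N : ℝ) ^ ((1 : ℝ) + ε) ≤
      (Set.ncard {k : Fin n → ℤ |
          gridCube n ((N : ℝ) ^ (-(1 + ε))) k ⊆ unitCube n ∧
          RoughlyBisected Q (gridCube n ((N : ℝ) ^ (-(1 + ε))) k) ∧
          (gridCube n ((N : ℝ) ^ (-(1 + ε))) k ∩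
            {y | ∃ t : ℝ, y = x + t • v}).Nonempty} : ℝ)

section BorsukUlam

/-- The mod 2 coboundary of a cochain `F` on vertex lists: the sum of `F` over all the lists
obtained by deleting one entry. -/
def coboundary {X : Type*} : (List X → ZMod 2) → List X → ZMod 2
  | _, [] => 0
  | F, x :: w => F w + coboundary (fun l => F (x :: l)) w

lemma coboundary_map {X Y : Type*} (φ : X → Y) (F : List Y → ZMod 2) (w : List X) :
    coboundary F (w.map φ) = coboundary (fun l => F (l.map φ)) w := by
  induction w generalizing F with
  | nil => rfl
  | cons x w ih => simp [coboundary, ih]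

lemma coboundary_add {X : Type*} (F G : List X → ZMod 2) (w : List X) :
    coboundary (fun l => F l + G l) w = coboundary F w + coboundary G w := by
  induction w generalizing F G with
  | nil => simp [coboundary]
  | cons x w ih => simp only [coboundary, ih]; ring

lemma coboundary_zero {X : Type*} (w : List X) :
    coboundary (fun _ => 0) w = 0 := by
  induction w with
  | nil => rfl
  | cons x w ih => simp [coboundary, ih]

lemma coboundary_congr {X : Type*} (P : List X → Prop) (hP : ∀ l l', l'.Sublist l → P l → P l')
    {F G : List X → ZMod 2} (h : ∀ l, P l → F l = G l) (w : List X) (hw : P w) :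
    coboundary F w = coboundary G w := by
  induction w generalizing F G P with
  | nil => rfl
  | cons x w ih =>
    simp only [coboundary]
    rw [h w (hP _ _ (by simp) hw)]
    congr 1
    refine ih (fun l => P (x :: l)) (fun l l' hl h => hP _ _ (by simpa using hl) h)
      (fun l hl => h _ hl) hw

lemma coboundary_perm {X : Type*} {F : List X → ZMod 2}
    (hF : ∀ l l', l.Perm l' → F l = F l') {w w' : List X} (h : w.Perm w') :
    coboundary F w = coboundary F w' := by
  induction h generalizing F with
  | nil => rfl
  | cons x h ih =>
    simp only [coboundary]
    rw [hF _ _ h, ih (fun l l' hl => hF _ _ (hl.cons x))]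
  | swap x y l =>
    have : (fun l => F (y :: x :: l)) = (fun l => F (x :: y :: l)) :=
      funext fun l => hF _ _ (List.Perm.swap _ _ _)
    simp only [coboundary, this]
    ring
  | trans _ _ ih₁ ih₂ => rw [ih₁ hF, ih₂ hF]

/-- The prism cochain operator between the vertex maps `φ` and `ψ`. -/
def prism {X : Type*} (φ ψ : X → X) : (List X → ZMod 2) → List X → ZMod 2
  | _, [] => 0
  | F, x :: w => F (φ x :: ψ x :: w.map ψ) + prism φ ψ (fun l => F (φ x :: l)) w

lemma prism_add {X : Type*} (φ ψ : X → X) (F G : List X → ZMod 2) (w : List X) :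
    prism φ ψ (fun l => F l + G l) w = prism φ ψ F w + prism φ ψ G w := by
  induction w generalizing F G with
  | nil => simp [prism]
  | cons x w ih => simp only [prism, ih]; ring

lemma prism_coboundary {X : Type*} (φ ψ : X → X) (F : List X → ZMod 2) (w : List X) :
    prism φ ψ (coboundary F) w =
      F (w.map φ) + F (w.map ψ) + coboundary (prism φ ψ F) w := by
  have h2 : ∀ a : ZMod 2, a + a = 0 := CharTwo.add_self_eq_zero
  induction w generalizing F with
  | nil => simp [prism, coboundary, h2]
  | cons x w ih =>
    simp only [prism, coboundary, prism_add, coboundary_add, ih, List.map_cons,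
      coboundary_map]
    linear_combination h2 (F (φ x :: w.map ψ))

/-- The prism over a list `w` only involves lists one entry longer, whose entries are all
`φ` or `ψ` of entries of `w`. -/
lemma prism_congr {X : Type*} (φ ψ : X → X) {F G : List X → ZMod 2} (w : List X)
    (h : ∀ l : List X, l.length = w.length + 1 →
      (∀ y ∈ l, ∃ x ∈ w, y = φ x ∨ y = ψ x) → F l = G l) :
    prism φ ψ F w = prism φ ψ G w := by
  induction w generalizing F G with
  | nil => rfl
  | cons x w ih =>
    simp only [prism]
    congr 1
    · apply h
      · simp
      · intro y hy
        simp only [List.mem_cons, List.mem_map] at hy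
        rcases hy with rfl | rfl | ⟨z, hz, rfl⟩
        · exact ⟨x, by simp, Or.inl rfl⟩
        · exact ⟨x, by simp, Or.inr rfl⟩
        · exact ⟨z, by simp [hz], Or.inr rfl⟩
    · apply ih
      intro l hl hy
      apply h
      · simp [hl]
      · intro y hy'
        rcases List.mem_cons.1 hy' with rfl | hy'
        · exact ⟨x, by simp, Or.inl rfl⟩
        · obtain ⟨z, hz, hz'⟩ := hy y hy'
          exact ⟨z, by simp [hz], hz'⟩

/-- `1` on lists of signs alternating and starting with the sign `s`, and `0` otherwise. -/
def alternatingFrom : Bool → List Bool → ZMod 2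
  | _, [] => 1
  | s, x :: w => if x = s then alternatingFrom (!s) w else 0

lemma coboundary_alternatingFrom (s : Bool) (w : List Bool) :
    coboundary (alternatingFrom s) w = alternatingFrom s w + alternatingFrom (!s) w := by
  have h2 : ∀ a : ZMod 2, a + a = 0 := CharTwo.add_self_eq_zero
  induction w generalizing s with
  | nil => simp [coboundary, alternatingFrom, h2]
  | cons x w ih =>
    by_cases hx : x = s
    · have : (fun l => alternatingFrom s (x :: l)) = alternatingFrom (!s) := by
        funext l; simp [alternatingFrom, hx]
      simp only [coboundary, this, ih]
      subst hx
      simp [alternatingFrom]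
      linear_combination h2 (alternatingFrom x w)
    · have : (fun l => alternatingFrom s (x :: l)) = fun _ => 0 := by
        funext l; simp [alternatingFrom, hx]
      have hx' : x = !s := by cases x <;> cases s <;> simp_all
      simp only [coboundary, this, coboundary_zero]
      subst hx'
      simp [alternatingFrom]

/-- The alternating cochain on lists of signed labels: `1` when the labels have distinct absolute
values and, sorted by absolute value, alternate in sign starting with `s`. -/
def fanCochain {K : ℕ} (s : Bool) (w : List (Fin K × Bool)) : ZMod 2 :=
  if (w.map Prod.fst).Nodup then
    alternatingFrom s ((w.mergeSort (fun a b => decide (toLex a ≤ toLex b))).map Prod.snd) else 0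

lemma pairwise_mergeSort_lex {K : ℕ} (w : List (Fin K × Bool)) :
    (w.mergeSort (fun a b => decide (toLex a ≤ toLex b))).Pairwise
      (fun a b => toLex a ≤ toLex b) := by
  have := List.pairwise_mergeSort (le := fun a b : Fin K × Bool => decide (toLex a ≤ toLex b))
    (fun a b c h₁ h₂ => by simp only [decide_eq_true_eq] at *; exact h₁.trans h₂)
    (fun a b => by simpa using le_total (toLex a) (toLex b)) w
  exact this.imp (fun h => by simpa using h)

lemma fanCochain_perm {K : ℕ} (s : Bool) (w w' : List (Fin K × Bool)) (h : w.Perm w') :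
    fanCochain s w = fanCochain s w' := by
  have h1 : w.mergeSort (fun a b => decide (toLex a ≤ toLex b)) =
      w'.mergeSort (fun a b => decide (toLex a ≤ toLex b)) := by
    apply List.Perm.eq_of_pairwise (le := fun a b => toLex a ≤ toLex b)
    · intro a b _ _ h₁ h₂
      exact toLex.injective (le_antisymm h₁ h₂)
    · exact pairwise_mergeSort_lex w
    · exact pairwise_mergeSort_lex w'
    · exact ((List.mergeSort_perm _ _).trans h).trans (List.mergeSort_perm _ _).symm
  have h2 : (w.map Prod.fst).Nodup ↔ (w'.map Prod.fst).Nodup := (h.map _).nodup_iff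
  simp only [fanCochain, h1, h2]

/-- Fan's identity, for label lists without a pair of opposite labels. -/
lemma coboundary_fanCochain {K : ℕ} (s : Bool) (w : List (Fin K × Bool))
    (hw : ∀ a ∈ w, ∀ b ∈ w, a.1 = b.1 → a = b) :
    coboundary (fanCochain s) w = fanCochain s w + fanCochain (!s) w := by
  by_cases hn : (w.map Prod.fst).Nodup
  · set w' := w.mergeSort (fun a b => decide (toLex a ≤ toLex b)) with hw'
    have hp : w.Perm w' := (List.mergeSort_perm _ _).symm
    have hs : w'.Pairwise (fun a b => toLex a ≤ toLex b) := pairwise_mergeSort_lex w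
    have hn' : (w'.map Prod.fst).Nodup := (hp.map _).nodup_iff.1 hn
    have key : ∀ s, ∀ l : List (Fin K × Bool), l.Sublist w' →
        fanCochain s l = alternatingFrom s (l.map Prod.snd) := by
      intro s l hl
      rw [fanCochain, if_pos (hn'.sublist (hl.map _)), List.mergeSort_of_pairwise]
      exact (hs.sublist hl).imp (fun h => by simpa using h)
    rw [coboundary_perm (fanCochain_perm s) hp, fanCochain_perm s _ _ hp,
      fanCochain_perm (!s) _ _ hp,
      coboundary_congr (fun l => l.Sublist w') (fun l l' h₁ h₂ => h₁.trans h₂) (key s) w'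
        (List.Sublist.refl _),
      ← coboundary_map Prod.snd (alternatingFrom s), coboundary_alternatingFrom,
      key _ _ (List.Sublist.refl _), key _ _ (List.Sublist.refl _)]
  · have h0 : ∀ s, fanCochain s w = 0 := fun s => if_neg hn
    rw [h0, h0, add_zero]
    obtain ⟨a, ha⟩ := List.exists_duplicate_iff_not_nodup.2 hn
    obtain ⟨l, hl, hl'⟩ := List.sublist_map_iff.1 (List.duplicate_iff_sublist.1 ha)
    rcases l with _ | ⟨p, _ | ⟨q, _ | ⟨r, l⟩⟩⟩
    · simp at hl'
    · simp at hl'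
    · simp only [List.map_cons, List.map_nil, List.cons.injEq, and_true] at hl'
      have hpq : p = q := hw p (hl.subset (by simp)) q (hl.subset (by simp))
        (hl'.1.symm.trans hl'.2)
      subst hpq
      obtain ⟨u, hu⟩ := hl.exists_perm_append
      rw [coboundary_perm (fanCochain_perm s) hu]
      have : (fun l => fanCochain s (p :: p :: l)) = fun _ => 0 := by
        funext l; simp [fanCochain]
      simp only [List.cons_append, List.nil_append, coboundary, this, coboundary_zero]
      rw [add_zero, CharTwo.add_self_eq_zero]
    · simp at hl'

lemma alternatingFrom_map_not (s : Bool) (w : List Bool) :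
    alternatingFrom s (w.map (!·)) = alternatingFrom (!s) w := by
  induction w generalizing s with
  | nil => rfl
  | cons x w ih => cases x <;> cases s <;> simp [alternatingFrom, ih]

lemma fanCochain_map_not {K : ℕ} (s : Bool) (w : List (Fin K × Bool)) :
    fanCochain s (w.map (fun a => (a.1, !a.2))) = fanCochain (!s) w := by
  by_cases hn : (w.map Prod.fst).Nodup
  · set w' := w.mergeSort (fun a b => decide (toLex a ≤ toLex b)) with hw'
    have hp : w.Perm w' := (List.mergeSort_perm _ _).symm
    have hs : w'.Pairwise (fun a b => toLex a ≤ toLex b) := pairwise_mergeSort_lex w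
    have hn' : (w'.map Prod.fst).Nodup := (hp.map _).nodup_iff.1 hn
    rw [fanCochain_perm (!s) _ _ hp, fanCochain_perm s _ _ (hp.map _)]
    have hs' : w'.Pairwise (fun a b => a.1 < b.1) := by
      have h2 : w'.Pairwise (fun a b => a.1 ≠ b.1) := List.pairwise_map.1 hn'
      refine (hs.and h2).imp ?_
      rintro a b ⟨h₁, h₂⟩
      rcases Prod.Lex.le_iff.1 h₁ with h | h
      · exact h
      · exact absurd h.1 h₂
    rw [fanCochain, fanCochain, if_pos hn', if_pos (by simpa [Function.comp_def] using hn'),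
      List.mergeSort_of_pairwise, List.mergeSort_of_pairwise, ← alternatingFrom_map_not]
    · simp [Function.comp_def]
    · exact hs.imp (fun h => by simpa using h)
    · rw [List.pairwise_map]
      refine hs'.imp fun {a b} h => ?_
      simp only [decide_eq_true_eq]
      exact Prod.Lex.le_iff.2 (Or.inl h)
  · rw [fanCochain, fanCochain, if_neg hn, if_neg (by simpa [Function.comp_def] using hn)]

/-- The point at parameter `s / T` of the segment from `x` to `p`. -/
noncomputable def segmentStep {m : ℕ} (p : Fin m → ℝ) (T s : ℕ) (x : Fin m → ℝ) : Fin m → ℝ :=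
  fun j => (1 - (s : ℝ) / T) * x j + (s : ℝ) / T * p j

/-- The `i`-th vertex of the crosspolytope. -/
def crossVertex (m i : ℕ) : Fin m → ℝ := fun j => if (j : ℕ) = i then 1 else 0

/-- Small `i`-dimensional simplices on the sphere spanned by the first `i + 1` coordinates. -/
def IsFineSimplex {m : ℕ} (i : ℕ) (η : ℝ) (w : List (Fin m → ℝ)) : Prop :=
  w.length = i + 1 ∧
  (∀ x ∈ w, ∑ j, |x j| = 1 ∧ ∀ j : Fin m, i < (j : ℕ) → x j = 0) ∧
  ∀ x ∈ w, ∀ y ∈ w, ∀ j, |x j - y j| ≤ η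

/-- Evaluation of cochains on a fine triangulation of the upper `i`-dimensional hemisphere, built
by coning off, in `T` steps, the union of the previous hemisphere and its antipode. -/
noncomputable def hemisphere (m T : ℕ) : ℕ → (List (Fin m → ℝ) → ZMod 2) → ZMod 2
  | 0, F => F [crossVertex m 0]
  | i + 1, F =>
    let Z : (List (Fin m → ℝ) → ZMod 2) → ZMod 2 := fun G =>
      hemisphere m T i G + hemisphere m T i (fun w => G (w.map (-·)))
    ∑ s ∈ Finset.range T, Z (prism (segmentStep (crossVertex m (i + 1)) T s)
        (segmentStep (crossVertex m (i + 1)) T (s + 1)) F) +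
      Z (fun w => F (crossVertex m (i + 1) ::
        w.map (segmentStep (crossVertex m (i + 1)) T T)))

lemma hemisphere_add (m T i : ℕ) (F G : List (Fin m → ℝ) → ZMod 2) :
    hemisphere m T i (fun w => F w + G w) = hemisphere m T i F + hemisphere m T i G := by
  induction i generalizing F G with
  | zero => rfl
  | succ i ih =>
    have h : ∀ φ ψ : (Fin m → ℝ) → (Fin m → ℝ), prism φ ψ (fun w => F w + G w) =
      fun w => prism φ ψ F w + prism φ ψ G w := fun φ ψ => funext fun w => prism_add _ _ _ _ _
    simp only [hemisphere, h, ih, Finset.sum_add_distrib]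
    ring

lemma segmentStep_zero {m : ℕ} (p : Fin m → ℝ) (T : ℕ) : segmentStep p T 0 = id := by
  funext x j; simp [segmentStep]

lemma hemisphere_coboundary_of_cycle (m T i : ℕ)
    (hcyc : ∀ F : List (Fin m → ℝ) → ZMod 2, hemisphere m T i (coboundary F) +
      hemisphere m T i (coboundary (fun w => F (w.map (-·)))) = 0)
    (F : List (Fin m → ℝ) → ZMod 2) :
    hemisphere m T (i + 1) (coboundary F) =
      hemisphere m T i F + hemisphere m T i (fun w => F (w.map (-·))) := by
  have h2 : ∀ a : ZMod 2, a + a = 0 := CharTwo.add_self_eq_zero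
  have hneg : ∀ F : List (Fin m → ℝ) → ZMod 2, (fun w => coboundary F (w.map (-·))) =
      coboundary (fun w => F (w.map (-·))) := fun F => funext fun w => coboundary_map _ _ _
  obtain ⟨Z, hZ⟩ : ∃ Z : (List (Fin m → ℝ) → ZMod 2) → ZMod 2, ∀ G, Z G =
    hemisphere m T i G + hemisphere m T i (fun w => G (w.map (-·))) := ⟨_, fun _ => rfl⟩
  have hZadd : ∀ F G, Z (fun w => F w + G w) = Z F + Z G := by
    intro F G
    rw [hZ, hZ, hZ, hemisphere_add, hemisphere_add]
    ring
  have hZcob : ∀ F, Z (coboundary F) = 0 := by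
    intro F
    rw [hZ, hneg, hcyc]
  set p := crossVertex m (i + 1)
  have hstep : ∀ s, Z (prism (segmentStep p T s) (segmentStep p T (s + 1)) (coboundary F)) =
      Z (fun w => F (w.map (segmentStep p T (s + 1)))) -
        Z (fun w => F (w.map (segmentStep p T s))) := by
    intro s
    have : prism (segmentStep p T s) (segmentStep p T (s + 1)) (coboundary F) = fun w =>
        (F (w.map (segmentStep p T s)) + F (w.map (segmentStep p T (s + 1)))) +
          coboundary (prism (segmentStep p T s) (segmentStep p T (s + 1)) F) w :=
      funext fun w => prism_coboundary _ _ _ _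
    rw [this, hZadd, hZadd, hZcob, add_zero, CharTwo.sub_eq_add, add_comm]
  have hcone : Z (fun w => coboundary F (p :: w.map (segmentStep p T T))) =
      Z (fun w => F (w.map (segmentStep p T T))) := by
    have : (fun w => coboundary F (p :: w.map (segmentStep p T T))) = fun w =>
        F (w.map (segmentStep p T T)) +
          coboundary (fun w => F (p :: w.map (segmentStep p T T))) w := by
      funext w
      simp only [coboundary, coboundary_map]
    rw [this, hZadd, hZcob, add_zero]
  have hdef : hemisphere m T (i + 1) (coboundary F) =
      ∑ s ∈ Finset.range T,
        Z (prism (segmentStep p T s) (segmentStep p T (s + 1)) (coboundary F)) +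
      Z (fun w => coboundary F (p :: w.map (segmentStep p T T))) := by
    simp only [hZ]; rfl
  rw [hdef, hcone, Finset.sum_congr rfl (fun s _ => hstep s),
    Finset.sum_range_sub (fun s => Z (fun w => F (w.map (segmentStep p T s)))), segmentStep_zero,
    ← hZ]
  simp only [List.map_id, CharTwo.sub_eq_add]
  linear_combination h2 (Z (fun w => F (w.map (segmentStep p T T))))

lemma hemisphere_coboundary (m T i : ℕ) (F : List (Fin m → ℝ) → ZMod 2) :
    hemisphere m T (i + 1) (coboundary F) =
      hemisphere m T i F + hemisphere m T i (fun w => F (w.map (-·))) := by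
  have h2 : ∀ a : ZMod 2, a + a = 0 := CharTwo.add_self_eq_zero
  apply hemisphere_coboundary_of_cycle
  induction i with
  | zero => intro F; simp [hemisphere, coboundary, h2]
  | succ i ih =>
    intro F
    rw [hemisphere_coboundary_of_cycle m T i ih, hemisphere_coboundary_of_cycle m T i ih]
    simp only [List.map_map, Function.comp_def, neg_neg, List.map_id']
    linear_combination h2 (hemisphere m T i F) + h2 (hemisphere m T i (fun w => F (w.map (-·))))

lemma IsFineSimplex.neg {m i : ℕ} {η : ℝ} {w : List (Fin m → ℝ)} (hw : IsFineSimplex i η w) :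
    IsFineSimplex i η (w.map (-·)) := by
  obtain ⟨h₁, h₂, h₃⟩ := hw
  refine ⟨by simpa using h₁, ?_, ?_⟩
  · intro x hx
    obtain ⟨y, hy, rfl⟩ := List.mem_map.1 hx
    simpa using h₂ y hy
  · intro x hx x' hx' j
    obtain ⟨y, hy, rfl⟩ := List.mem_map.1 hx
    obtain ⟨y', hy', rfl⟩ := List.mem_map.1 hx'
    have := h₃ y' hy' y hy j
    simpa [neg_add_eq_sub] using this

lemma sum_crossVertex {m i : ℕ} (hi : i < m) : ∑ j, crossVertex m i j = 1 := by
  rw [Finset.sum_eq_single (⟨i, hi⟩ : Fin m)]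
  · simp [crossVertex]
  · intro b _ hb
    exact if_neg fun h => hb (Fin.ext h)
  · simp

lemma crossVertex_nonneg (m i : ℕ) (j : Fin m) : 0 ≤ crossVertex m i j := by
  unfold crossVertex; split_ifs <;> norm_num

lemma segmentStep_mem {m i T s : ℕ} (hi : i + 1 < m) (hT : 0 < T) (hs : s ≤ T) {x : Fin m → ℝ}
    (hx : ∑ j, |x j| = 1 ∧ ∀ j : Fin m, i < (j : ℕ) → x j = 0) :
    ∑ j, |segmentStep (crossVertex m (i + 1)) T s x j| = 1 ∧
      ∀ j : Fin m, i + 1 < (j : ℕ) → segmentStep (crossVertex m (i + 1)) T s x j = 0 := by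
  have hT' : (0 : ℝ) < T := by exact_mod_cast hT
  have ha : (s : ℝ) / T ≤ 1 := (div_le_one hT').2 (by exact_mod_cast hs)
  have ha0 : 0 ≤ (s : ℝ) / T := by positivity
  constructor
  · have : ∀ j, |segmentStep (crossVertex m (i + 1)) T s x j| =
        (1 - (s : ℝ) / T) * |x j| + (s : ℝ) / T * crossVertex m (i + 1) j := by
      intro j
      unfold segmentStep
      by_cases hj : (j : ℕ) = i + 1
      · rw [hx.2 j (by omega)]
        rw [mul_zero, zero_add, abs_zero, mul_zero, zero_add,
          abs_of_nonneg (mul_nonneg ha0 (crossVertex_nonneg m (i + 1) j))]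
      · have : crossVertex m (i + 1) j = 0 := if_neg hj
        rw [this, mul_zero, add_zero, add_zero, abs_mul, abs_of_nonneg (by linarith)]
    simp only [this, Finset.sum_add_distrib, ← Finset.mul_sum, hx.1, sum_crossVertex hi]
    ring
  · intro j hj
    have h : crossVertex m (i + 1) j = 0 := if_neg (by omega)
    simp [segmentStep, hx.2 j (by omega), h]

lemma abs_le_one_of_sum_eq_one {m : ℕ} {x : Fin m → ℝ} (hx : ∑ j, |x j| = 1) (j : Fin m) :
    |x j| ≤ 1 :=
  hx ▸ Finset.single_le_sum (f := fun j => |x j|) (fun _ _ => abs_nonneg _) (Finset.mem_univ j)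

lemma segmentStep_dist {m i T s s' : ℕ} (hT : 0 < T) (hs : s ≤ T)
    (hss : s' = s ∨ s' = s + 1 ∨ s = s' + 1) {η : ℝ}
    (hη : 0 ≤ η) {x y : Fin m → ℝ} (hy : ∑ j, |y j| = 1) (hxy : ∀ j, |x j - y j| ≤ η)
    (j : Fin m) :
    |segmentStep (crossVertex m i) T s x j - segmentStep (crossVertex m i) T s' y j| ≤
      η + 2 / T := by
  have hT' : (0 : ℝ) < T := by exact_mod_cast hT
  have ha : (s : ℝ) / T ≤ 1 := (div_le_one hT').2 (by exact_mod_cast hs)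
  have ha0 : 0 ≤ (s : ℝ) / T := by positivity
  have hd : |((s' : ℝ) - s)| ≤ 1 := by
    rcases hss with rfl | rfl | rfl <;> simp
  have hp : |y j - crossVertex m i j| ≤ 2 := by
    have h1 := abs_le.1 (abs_le_one_of_sum_eq_one hy j)
    have h2 := crossVertex_nonneg m i j
    have h3 : crossVertex m i j ≤ 1 := by unfold crossVertex; split_ifs <;> norm_num
    rw [abs_le]; constructor <;> linarith [h1.1, h1.2]
  have heq : segmentStep (crossVertex m i) T s x j - segmentStep (crossVertex m i) T s' y j =
      (1 - (s : ℝ) / T) * (x j - y j) + (((s' : ℝ) - s) * (y j - crossVertex m i j)) / T := by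
    unfold segmentStep; field_simp; ring
  rw [heq]
  refine (abs_add_le _ _).trans (add_le_add ?_ ?_)
  · rw [abs_mul, abs_of_nonneg (by linarith : 0 ≤ 1 - (s : ℝ) / T)]
    nlinarith [hxy j, abs_nonneg (x j - y j)]
  · rw [abs_div, abs_mul, abs_of_pos hT']
    gcongr
    nlinarith [abs_nonneg ((s' : ℝ) - s), abs_nonneg (y j - crossVertex m i j)]

/-- The evaluation on the fine hemisphere only depends on the values on small simplices. -/
lemma hemisphere_congr (m T i : ℕ) (hT : 0 < T) (hi : i < m)
    {F G : List (Fin m → ℝ) → ZMod 2}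
    (h : ∀ w, IsFineSimplex i (2 * i / T) w → F w = G w) :
    hemisphere m T i F = hemisphere m T i G := by
  induction i generalizing F G with
  | zero =>
    apply h
    refine ⟨rfl, ?_, ?_⟩
    · intro x hx
      rw [List.mem_singleton.1 hx]
      constructor
      · simp only [abs_of_nonneg (crossVertex_nonneg m 0 _), sum_crossVertex hi]
      · intro j hj
        exact if_neg (by omega)
    · intro x hx y hy j
      rw [List.mem_singleton.1 hx, List.mem_singleton.1 hy]
      simp
  | succ i ih =>
    have hη : (0 : ℝ) ≤ 2 * i / T := by positivity
    have hηs : (2 : ℝ) * i / T + 2 / T = 2 * (i + 1 : ℕ) / T := by push_cast; ring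
    have hprism : ∀ s < T, ∀ w, IsFineSimplex i (2 * i / T) w →
        prism (segmentStep (crossVertex m (i + 1)) T s)
          (segmentStep (crossVertex m (i + 1)) T (s + 1)) F w =
        prism (segmentStep (crossVertex m (i + 1)) T s)
          (segmentStep (crossVertex m (i + 1)) T (s + 1)) G w := by
      rintro s hs w ⟨hw₁, hw₂, hw₃⟩
      apply prism_congr
      intro l hl hmem
      apply h
      refine ⟨by omega, ?_, ?_⟩
      · intro y hy
        obtain ⟨x, hx, rfl | rfl⟩ := hmem y hy
        · exact segmentStep_mem hi hT hs.le (hw₂ x hx)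
        · exact segmentStep_mem hi hT hs (hw₂ x hx)
      · intro y hy y' hy' j
        rw [← hηs]
        obtain ⟨x, hx, rfl | rfl⟩ := hmem y hy <;> obtain ⟨x', hx', rfl | rfl⟩ := hmem y' hy' <;>
        exact segmentStep_dist hT (by omega) (by omega) hη (hw₂ x' hx').1 (hw₃ x hx x' hx') j
    have hcone : ∀ w, IsFineSimplex i (2 * i / T) w →
        F (crossVertex m (i + 1) :: w.map (segmentStep (crossVertex m (i + 1)) T T)) =
        G (crossVertex m (i + 1) :: w.map (segmentStep (crossVertex m (i + 1)) T T)) := by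
      rintro w ⟨hw₁, hw₂, hw₃⟩
      apply h
      have hT' : (T : ℝ) ≠ 0 := by exact_mod_cast hT.ne'
      have hmem : ∀ y ∈ crossVertex m (i + 1) :: w.map (segmentStep (crossVertex m (i + 1)) T T),
          y = crossVertex m (i + 1) := by
        intro y hy
        rcases List.mem_cons.1 hy with rfl | hy
        · rfl
        · obtain ⟨x, -, rfl⟩ := List.mem_map.1 hy
          funext j
          simp [segmentStep, hT']
      refine ⟨by simp [hw₁], ?_, ?_⟩
      · intro y hy
        rw [hmem y hy]
        constructor
        · simp only [abs_of_nonneg (crossVertex_nonneg m (i + 1) _), sum_crossVertex hi]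
        · intro j hj
          exact if_neg (by omega)
      · intro y hy y' hy' j
        rw [hmem y hy, hmem y' hy', sub_self, abs_zero]
        positivity
    have hi' : i < m := by omega
    simp only [hemisphere]
    congr 1
    · refine Finset.sum_congr rfl fun s hs => ?_
      rw [Finset.mem_range] at hs
      rw [ih hi' (hprism s hs), ih hi' (fun w hw => hprism s hs _ hw.neg)]
    · rw [ih hi' hcone, ih hi' (fun w hw => hcone _ hw.neg)]

/-- A combinatorial form of the Borsuk–Ulam theorem, in the style of Tucker and Fan: an antipodal
labelling of the `K`-dimensional sphere by `±1, …, ±K` has opposite labels at two points that are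
as close as one wishes. -/
lemma exists_close_opposite_labels {K : ℕ} (label : (Fin (K + 1) → ℝ) → Fin K × Bool)
    (hlabel : ∀ x, ∑ j, |x j| = 1 → label (-x) = ((label x).1, !(label x).2))
    {η : ℝ} (hη : 0 < η) :
    ∃ x y, ∑ j, |x j| = 1 ∧ ∑ j, |y j| = 1 ∧ (∀ j, |x j - y j| ≤ η) ∧
      (label x).1 = (label y).1 ∧ (label x).2 ≠ (label y).2 := by
  by_contra! hcon
  have h2 : ∀ a : ZMod 2, a + a = 0 := CharTwo.add_self_eq_zero
  obtain ⟨T, hT⟩ := exists_nat_gt (2 * K / η)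
  have hT0 : 0 < T := by
    have : (0 : ℝ) < T := lt_of_le_of_lt (by positivity) hT
    exact_mod_cast this
  have hT' : (0 : ℝ) < T := by exact_mod_cast hT0
  set A : Bool → List (Fin (K + 1) → ℝ) → ZMod 2 := fun s w => fanCochain s (w.map label) with hA
  have hsmall : ∀ i ≤ K, (2 * i / T : ℝ) ≤ η := by
    intro i hi
    rw [div_lt_iff₀ hη] at hT
    rw [div_le_iff₀ hT']
    have : (i : ℝ) ≤ K := by exact_mod_cast hi
    nlinarith
  have hcob : ∀ i ≤ K, ∀ w, IsFineSimplex i (2 * i / T) w →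
      coboundary (A true) w = A true w + A false w := by
    rintro i hi w ⟨-, hw₂, hw₃⟩
    rw [hA]
    simp only
    rw [← coboundary_map label, coboundary_fanCochain]
    · rfl
    · intro a ha b hb hab
      obtain ⟨x, hx, rfl⟩ := List.mem_map.1 ha
      obtain ⟨y, hy, rfl⟩ := List.mem_map.1 hb
      exact Prod.ext hab (hcon x y (hw₂ x hx).1 (hw₂ y hy).1
        (fun j => (hw₃ x hx y hy j).trans (hsmall i hi)) hab)
  have hneg : ∀ i, ∀ w : List (Fin (K + 1) → ℝ), IsFineSimplex i (2 * i / T) w →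
      A true (w.map (-·)) = A false w := by
    rintro i w ⟨-, hw₂, -⟩
    have : (w.map (-·)).map label = (w.map label).map (fun a => (a.1, !a.2)) := by
      simp only [List.map_map]
      exact List.map_congr_left fun x hx => hlabel x (hw₂ x hx).1
    simp only [hA, this, fanCochain_map_not]
    rfl
  have hone : ∀ i ≤ K,
      hemisphere (K + 1) T i (A true) + hemisphere (K + 1) T i (A false) = 1 := by
    intro i hi
    induction i with
    | zero =>
      simp only [hemisphere, hA, fanCochain, List.map_cons, List.map_nil]
      cases h : (label (crossVertex (K + 1) 0)).2 <;> simp [alternatingFrom, h]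
    | succ i ih =>
      rw [← hemisphere_add, ← hemisphere_congr _ _ _ hT0 (by omega) (hcob (i + 1) hi),
        hemisphere_coboundary, hemisphere_congr _ _ _ hT0 (by omega) (hneg i), ih (by omega)]
  have hzero : ∀ s, hemisphere (K + 1) T K (A s) = 0 := by
    intro s
    have : hemisphere (K + 1) T K (A s) = hemisphere (K + 1) T K (fun _ => 0) := by
      refine hemisphere_congr _ _ _ hT0 (by omega) ?_
      rintro w ⟨hw₁, -, -⟩
      refine if_neg fun hn => ?_
      have := hn.length_le_card
      simp at this
      omega
    rw [this]
    have := hemisphere_add (K + 1) T K (fun _ => 0) (fun _ => 0)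
    simp only [add_zero] at this
    rw [this, h2]
  have := hone K le_rfl
  rw [hzero, hzero] at this
  simp at this

/-- The Borsuk–Ulam theorem, on the unit sphere of the `ℓ¹` norm. -/
theorem exists_zero_of_odd {K : ℕ} (f : (Fin (K + 1) → ℝ) → Fin K → ℝ)
    (hf : ContinuousOn f {x | ∑ j, |x j| = 1}) (hodd : ∀ x, f (-x) = -f x) :
    ∃ x, ∑ j, |x j| = 1 ∧ f x = 0 := by
  by_contra! hcon
  set S : Set (Fin (K + 1) → ℝ) := {x | ∑ j, |x j| = 1} with hS
  have hcomp : IsCompact S := by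
    apply Metric.isCompact_of_isClosed_isBounded
    · exact isClosed_eq (by fun_prop) continuous_const
    · refine (Metric.isBounded_closedBall (x := (0 : Fin (K + 1) → ℝ)) (r := 1)).subset ?_
      intro x hx
      rw [mem_closedBall_zero_iff, pi_norm_le_iff_of_nonneg zero_le_one]
      exact abs_le_one_of_sum_eq_one hx
  have hne : S.Nonempty := ⟨crossVertex (K + 1) 0, by
    simp only [hS, Set.mem_ofPred_eq, abs_of_nonneg (crossVertex_nonneg _ 0 _),
      sum_crossVertex (Nat.succ_pos K)]⟩
  obtain ⟨x₀, hx₀, hmin⟩ := hcomp.exists_isMinOn hne hf.norm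
  set θ := ‖f x₀‖ with hθ
  have hθ0 : 0 < θ := norm_pos_iff.2 (hcon x₀ hx₀)
  have hmin' : ∀ x ∈ S, ∃ j, θ ≤ |f x j| := by
    intro x hx
    by_contra! h
    exact absurd (hmin hx) (not_le.2 ((pi_norm_lt_iff hθ0).2 h))
  obtain ⟨η, hη, hunif⟩ := Metric.uniformContinuousOn_iff.1
    (hcomp.uniformContinuousOn_of_continuous hf) θ hθ0
  have hK : Nonempty (Fin K) := ⟨(hmin' x₀ hx₀).choose⟩
  set idx : (Fin (K + 1) → ℝ) → Fin K := fun x => Classical.epsilon fun j => θ ≤ |f x j|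
  have hidx : ∀ x ∈ S, θ ≤ |f x (idx x)| := fun x hx => Classical.epsilon_spec (hmin' x hx)
  have hidxneg : ∀ x, idx (-x) = idx x := by
    intro x
    simp only [idx, hodd, Pi.neg_apply, abs_neg]
  obtain ⟨x, y, hx, hy, hxy, h1, h2⟩ := exists_close_opposite_labels
    (fun x => (idx x, decide (0 < f x (idx x)))) (by
      intro x hx
      have h := hidx x hx
      simp only [hidxneg, hodd, Pi.neg_apply, Prod.mk.injEq, true_and]
      rcases lt_trichotomy (f x (idx x)) 0 with h' | h' | h'
      · simp [h', h'.le]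
      · rw [h', abs_zero] at h; linarith
      · simp [h', h'.le]) (half_pos hη)
  have hd : dist (f x) (f y) < θ := by
    apply hunif x hx y hy
    refine lt_of_le_of_lt ((dist_pi_le_iff (half_pos hη).le).2 fun j => ?_) (half_lt_self hη)
    exact hxy j
  have hd' := (dist_le_pi_dist (f x) (f y) (idx x)).trans_lt hd
  have hx' := hidx x hx
  have hy' := hidx y hy
  simp only at h1 h2
  rw [← h1] at hy' h2
  rw [Real.dist_eq, abs_lt] at hd'
  simp only [ne_eq, decide_eq_decide] at h2
  rcases le_abs.1 hx' with h | h <;> rcases le_abs.1 hy' with h' | h'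
  · exact h2 ⟨fun _ => by linarith, fun _ => by linarith⟩
  · linarith [hd'.2]
  · linarith [hd'.1]
  · exact h2 ⟨fun _ => by linarith, fun _ => by linarith⟩

end BorsukUlam

section PolynomialHamSandwich

/-- The zero set of a nonzero real polynomial has measure zero. -/
lemma volume_zeros_eq_zero {n : ℕ} (Q : MvPolynomial (Fin n) ℝ) (hQ : Q ≠ 0) :
    volume {x : Fin n → ℝ | MvPolynomial.eval x Q = 0} = 0 := by
  induction n with
  | zero =>
    obtain ⟨c, rfl⟩ := MvPolynomial.C_surjective (Fin 0) Q
    have hc : c ≠ 0 := by rintro rfl; simp at hQ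
    simp [hc]
  | succ n ih =>
    set p := MvPolynomial.finSuccEquiv ℝ n Q with hp
    have hp0 : p ≠ 0 := by simpa [hp] using hQ
    set e := MeasurableEquiv.piFinSuccAbove (fun _ : Fin (n + 1) => ℝ) 0
    have hmp : MeasurePreserving e := volume_preserving_piFinSuccAbove (fun _ => ℝ) 0
    set s : Set (ℝ × (Fin n → ℝ)) :=
      {z | Polynomial.eval z.1 (p.map (MvPolynomial.eval z.2)) = 0} with hs
    have hpre : {x : Fin (n + 1) → ℝ | MvPolynomial.eval x Q = 0} = e ⁻¹' s := by
      ext x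
      have hx : MvPolynomial.eval x Q =
          Polynomial.eval (x 0) (p.map (MvPolynomial.eval fun i => x i.succ)) := by
        rw [hp, ← MvPolynomial.eval_eq_eval_mv_eval']
        congr 1
        congr 1
        funext i
        refine Fin.cases ?_ (fun i => ?_) i <;> simp
      have h2 : (e x).1 = x 0 := rfl
      have h3 : (e x).2 = fun i => x i.succ := rfl
      simp only [hs, Set.mem_ofPred_eq, Set.mem_preimage, h2, h3, hx]
    have hsm : MeasurableSet s := by
      have : MeasurableSet (e.symm ⁻¹' {x : Fin (n + 1) → ℝ | MvPolynomial.eval x Q = 0}) := by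
        apply e.symm.measurable
        exact (isClosed_eq (MvPolynomial.continuous_eval Q) continuous_const).measurableSet
      rwa [hpre, ← Set.preimage_comp, e.self_comp_symm, Set.preimage_id] at this
    rw [hpre, hmp.measure_preimage hsm.nullMeasurableSet]
    rw [Measure.volume_eq_prod, Measure.prod_apply_symm hsm]
    have hcoeff : p.leadingCoeff ≠ 0 := by simpa using hp0
    have hae : ∀ᵐ y : Fin n → ℝ, MvPolynomial.eval y p.leadingCoeff ≠ 0 := by
      rw [ae_iff]
      simpa using ih _ hcoeff
    rw [← lintegral_zero (μ := (volume : Measure (Fin n → ℝ)))]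
    refine lintegral_congr_ae ?_
    filter_upwards [hae] with y hy
    have hne : p.map (MvPolynomial.eval y) ≠ 0 := by
      intro h
      apply hy
      have := congrArg (fun q => Polynomial.coeff q p.natDegree) h
      simpa [Polynomial.coeff_map] using this
    exact (Polynomial.finite_setOfPred_isRoot hne).measure_zero volume

/-- The sign of a real number, as a real number. -/
noncomputable def realSign (q : ℝ) : ℝ :=
  (Set.Ioi (0 : ℝ)).indicator 1 q - (Set.Iio (0 : ℝ)).indicator 1 q

lemma realSign_neg (q : ℝ) : realSign (-q) = -realSign q := by
  simp [realSign, Set.indicator_apply]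

lemma measurable_realSign : Measurable realSign :=
  (measurable_one.indicator measurableSet_Ioi).sub (measurable_one.indicator measurableSet_Iio)

lemma abs_realSign_le (q : ℝ) : |realSign q| ≤ 1 := by
  rcases lt_trichotomy q 0 with h | h | h
  · simp [realSign, h, h.le]
  · simp [realSign, h]
  · simp [realSign, h, h.le]

lemma continuousAt_realSign {q : ℝ} (hq : q ≠ 0) : ContinuousAt realSign q := by
  rcases lt_or_gt_of_ne hq with h | h
  · have : realSign =ᶠ[nhds q] fun _ => -1 := by
      filter_upwards [Iio_mem_nhds h] with x hx
      simp [realSign, Set.mem_Iio.1 hx, (Set.mem_Iio.1 hx).le]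
    exact (continuousAt_congr this).2 continuousAt_const
  · have : realSign =ᶠ[nhds q] fun _ => 1 := by
      filter_upwards [Ioi_mem_nhds h] with x hx
      simp [realSign, Set.mem_Ioi.1 hx, (Set.mem_Ioi.1 hx).le]
    exact (continuousAt_congr this).2 continuousAt_const

/-- If the sign of `Q` has mean zero on a set of finite measure, then `Q` bisects this set. -/
lemma bisects_of_integral_realSign_eq_zero {n : ℕ} (Q : MvPolynomial (Fin n) ℝ) (hQ : Q ≠ 0)
    (Δ : Set (Fin n → ℝ)) (hfin : volume Δ ≠ ∞)
    (hint : ∫ y in Δ, realSign (MvPolynomial.eval y Q) = 0) :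
    volume Δ / 2 ≤ volume (Δ ∩ {y | 0 < MvPolynomial.eval y Q}) ∧
    volume Δ / 2 ≤ volume (Δ ∩ {y | MvPolynomial.eval y Q < 0}) := by
  set A : Set (Fin n → ℝ) := {y | 0 < MvPolynomial.eval y Q} with hA
  set B : Set (Fin n → ℝ) := {y | MvPolynomial.eval y Q < 0} with hB
  have hAm : MeasurableSet A :=
    (isOpen_lt continuous_const (MvPolynomial.continuous_eval Q)).measurableSet
  have hBm : MeasurableSet B :=
    (isOpen_lt (MvPolynomial.continuous_eval Q) continuous_const).measurableSet
  have hfin' : volume (Δ ∩ A) ≠ ∞ := measure_ne_top_of_subset Set.inter_subset_left hfin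
  have hfin'' : volume (Δ ∩ B) ≠ ∞ := measure_ne_top_of_subset Set.inter_subset_left hfin
  have : IsFiniteMeasure (volume.restrict Δ) := ⟨by simpa using hfin.lt_top⟩
  have heq : (fun y => realSign (MvPolynomial.eval y Q)) =
      fun y => A.indicator (1 : (Fin n → ℝ) → ℝ) y - B.indicator (1 : (Fin n → ℝ) → ℝ) y := by
    funext y
    simp [realSign, Set.indicator_apply, hA, hB]
  have hAi : Integrable (A.indicator (1 : (Fin n → ℝ) → ℝ)) (volume.restrict Δ) :=
    (integrable_const (1 : ℝ)).indicator hAm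
  have hBi : Integrable (B.indicator (1 : (Fin n → ℝ) → ℝ)) (volume.restrict Δ) :=
    (integrable_const (1 : ℝ)).indicator hBm
  rw [heq, integral_sub hAi hBi, integral_indicator_one hAm,
    integral_indicator_one hBm, measureReal_restrict_apply hAm, measureReal_restrict_apply hBm,
    sub_eq_zero, Set.inter_comm, Set.inter_comm B] at hint
  have hAB : volume (Δ ∩ A) = volume (Δ ∩ B) :=
    (measureReal_eq_measureReal_iff hfin' hfin'').1 hint
  have hle : volume Δ ≤ volume (Δ ∩ A) + volume (Δ ∩ B) := by
    calc volume Δ ≤ volume ((Δ ∩ A) ∪ (Δ ∩ B) ∪ {y | MvPolynomial.eval y Q = 0}) := by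
          apply measure_mono
          intro y hy
          rcases lt_trichotomy (MvPolynomial.eval y Q) 0 with h | h | h
          · exact Or.inl (Or.inr ⟨hy, h⟩)
          · exact Or.inr h
          · exact Or.inl (Or.inl ⟨hy, h⟩)
      _ ≤ volume ((Δ ∩ A) ∪ (Δ ∩ B)) + volume {y | MvPolynomial.eval y Q = 0} :=
          measure_union_le _ _
      _ ≤ _ := by
          rw [volume_zeros_eq_zero Q hQ, add_zero]
          exact measure_union_le _ _
  constructor
  · rw [ENNReal.div_le_iff (by simp) (by simp), mul_two]
    exact hle.trans_eq (by rw [hAB])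
  · rw [ENNReal.div_le_iff (by simp) (by simp), mul_two]
    exact hle.trans_eq (by rw [hAB])

/-- The polynomial ham sandwich theorem. -/
theorem exists_polynomial_bisecting {n D K : ℕ} (hK : K < (D / n + 1) ^ n)
    (Δ : Fin K → Set (Fin n → ℝ)) (hfin : ∀ k, volume (Δ k) ≠ ∞) :
    ∃ Q : MvPolynomial (Fin n) ℝ, Q ≠ 0 ∧ Q.totalDegree ≤ D ∧ ∀ k,
      volume (Δ k) / 2 ≤ volume (Δ k ∩ {y | 0 < MvPolynomial.eval y Q}) ∧
      volume (Δ k) / 2 ≤ volume (Δ k ∩ {y | MvPolynomial.eval y Q < 0}) := by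
  obtain ⟨g⟩ : Nonempty (Fin (K + 1) ↪ (Fin n → Fin (D / n + 1))) := by
    apply Function.Embedding.nonempty_of_card_le
    simpa using hK
  set expo : Fin (K + 1) → (Fin n →₀ ℕ) := fun j =>
    Finsupp.equivFunOnFinite.symm fun i => (g j i : ℕ) with hexpo
  have hinj : Function.Injective expo := by
    intro j j' h
    apply g.injective
    funext i
    have := DFunLike.congr_fun h i
    exact Fin.ext (by simpa [hexpo] using this)
  set P : (Fin (K + 1) → ℝ) → MvPolynomial (Fin n) ℝ := fun x =>
    ∑ j, MvPolynomial.monomial (expo j) (x j) with hP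
  have hP0 : ∀ x, ∑ j, |x j| = 1 → P x ≠ 0 := by
    intro x hx h0
    have : ∀ j, x j = 0 := by
      intro j
      have := congrArg (MvPolynomial.coeff (expo j)) h0
      simpa [hP, MvPolynomial.coeff_sum, MvPolynomial.coeff_monomial, hinj.eq_iff] using this
    simp [this] at hx
  have hPeval : ∀ x y, MvPolynomial.eval y (P x) = ∑ j, x j * ∏ i, y i ^ (g j i : ℕ) := by
    intro x y
    simp [hP, MvPolynomial.eval_monomial, Finsupp.prod_fintype, hexpo]
  have hPneg : ∀ x y, MvPolynomial.eval y (P (-x)) = -MvPolynomial.eval y (P x) := by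
    intro x y
    simp [hPeval]
  have hdeg : ∀ x, (P x).totalDegree ≤ D := by
    intro x
    refine MvPolynomial.totalDegree_finsetSum_le fun j _ => ?_
    refine (MvPolynomial.totalDegree_monomial_le _ _).trans ?_
    rw [Finsupp.sum_fintype _ _ (by simp)]
    calc ∑ i, expo j i ≤ ∑ _i : Fin n, D / n :=
          Finset.sum_le_sum fun i _ => by
            simpa [hexpo] using Nat.lt_succ_iff.1 (g j i).2
      _ ≤ D := by simpa using Nat.mul_div_le D n
  obtain ⟨x, hx, hfx⟩ := exists_zero_of_odd
    (fun x k => ∫ y in Δ k, realSign (MvPolynomial.eval y (P x))) (by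
      rw [continuousOn_pi]
      intro k x hx
      have : IsFiniteMeasure (volume.restrict (Δ k)) := ⟨by simpa using (hfin k).lt_top⟩
      refine continuousWithinAt_of_dominated (bound := fun _ => 1) ?_ ?_ (integrable_const _) ?_
      · filter_upwards with x
        exact (measurable_realSign.comp
          (MvPolynomial.continuous_eval _).measurable).aestronglyMeasurable
      · filter_upwards with x
        filter_upwards with y
        exact abs_realSign_le _
      · apply ae_restrict_of_ae
        have hae : ∀ᵐ y : Fin n → ℝ, MvPolynomial.eval y (P x) ≠ 0 := by
          rw [ae_iff]
          simpa using volume_zeros_eq_zero _ (hP0 x hx)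
        filter_upwards [hae] with y hy
        apply ContinuousAt.continuousWithinAt
        refine ContinuousAt.comp (f := fun x => MvPolynomial.eval y (P x)) (g := realSign)
          (continuousAt_realSign hy) ?_
        simp only [hPeval]
        exact (continuous_finsetSum _ fun j _ =>
          (continuous_apply j).mul continuous_const).continuousAt) (by
      intro x
      funext k
      simp only [hPneg, realSign_neg, integral_neg, Pi.neg_apply])
  exact ⟨P x, hP0 x hx, hdeg x, fun k =>
    bisects_of_integral_realSign_eq_zero _ (hP0 x hx) _ (hfin k) (congrFun hfx k)⟩

end PolynomialHamSandwich

section Counting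

/-- Sets of which at most `C` overlap at any point have total measure at most `C` times the measure
of their ambient set. -/
lemma sum_measure_le_of_overlap {ι α : Type*} [MeasurableSpace α] (μ : Measure α) (T : Finset ι)
    (E : ι → Set α) (U : Set α) (hE : ∀ k ∈ T, MeasurableSet (E k)) (hU : MeasurableSet U)
    (hEU : ∀ k ∈ T, E k ⊆ U) (C : ℕ)
    (hC : ∀ p ∈ U, ∀ B ⊆ T, (∀ k ∈ B, p ∈ E k) → B.card ≤ C) :
    ∑ k ∈ T, μ (E k) ≤ C * μ U := by
  classical
  calc ∑ k ∈ T, μ (E k) = ∑ k ∈ T, ∫⁻ p, (E k).indicator 1 p ∂μ :=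
        Finset.sum_congr rfl fun k hk => (lintegral_indicator_one (hE k hk)).symm
    _ = ∫⁻ p, ∑ k ∈ T, (E k).indicator 1 p ∂μ :=
        (lintegral_finsetSum' _ fun k hk => (measurable_one.indicator (hE k hk)).aemeasurable).symm
    _ ≤ ∫⁻ p, U.indicator (fun _ => (C : ℝ≥0∞)) p ∂μ := by
        refine lintegral_mono fun p => ?_
        by_cases hp : p ∈ U
        · rw [Set.indicator_of_mem hp]
          have := hC p hp (T.filter fun k => p ∈ E k) (Finset.filter_subset _ _)
            (fun k hk => (Finset.mem_filter.1 hk).2)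
          simp only [Set.indicator_apply, Pi.one_apply, Finset.sum_boole]
          exact_mod_cast this
        · rw [Set.indicator_of_notMem hp]
          exact (Finset.sum_eq_zero fun k hk =>
            Set.indicator_of_notMem (fun h => hp (hEU k hk h)) _).le
    _ = C * μ U := lintegral_indicator_const hU _

/-- A polynomial of degree at most `N` changes sign, along lines in the `i`-th coordinate
direction, in a bounded number of the boxes of a grid. -/
lemma card_sign_changes_line_le {n N m : ℕ} {s : ℝ} (hs : 0 < s) (Q : MvPolynomial (Fin n) ℝ)
    (hQ : Q.totalDegree ≤ N) (i : Fin n) (x y : Fin n → ℝ) (hxy : ∀ j, j ≠ i → x j = y j)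
    (hx : 0 ≤ x i ∧ x i < s) (hy : 0 ≤ y i ∧ y i < s) (B : Finset (Fin n → ℤ))
    (hB : ∀ k ∈ B, ∀ j, 0 ≤ k j ∧ k j < m)
    (hBx : ∀ k ∈ B, 0 < MvPolynomial.eval (fun j => k j * s + x j) Q)
    (hBy : ∀ k ∈ B, MvPolynomial.eval (fun j => k j * s + y j) Q ≤ 0) :
    B.card ≤ N * m ^ (n - 1) := by
  classical
  set f : (Fin n → ℤ) → ({j // j ≠ i} → ℤ) := fun k j => k j with hf
  have himage : (B.image f).card ≤ m ^ (n - 1) := by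
    have hsub : B.image f ⊆ Fintype.piFinset fun _ => Finset.Ico (0 : ℤ) m := by
      intro a ha
      obtain ⟨k, hk, rfl⟩ := Finset.mem_image.1 ha
      simp only [Fintype.mem_piFinset, Finset.mem_Ico]
      exact fun j => hB k hk j
    refine (Finset.card_le_card hsub).trans ?_
    simp
  refine (Finset.card_le_mul_card_image B N fun a _ => ?_).trans (Nat.mul_le_mul_left N himage)
  rcases (B.filter fun k => f k = a).eq_empty_or_nonempty with h | ⟨k₀, hk₀⟩
  · simp [h]
  obtain ⟨hk₀B, hk₀a⟩ := Finset.mem_filter.1 hk₀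
  set w : Fin n → ℝ := fun j => k₀ j * s + x j with hw
  set q : Polynomial ℝ := MvPolynomial.aeval
    (fun j => if j = i then Polynomial.X else Polynomial.C (w j)) Q with hq
  have hqeval : ∀ t, q.eval t = MvPolynomial.eval (Function.update w i t) Q := by
    intro t
    have : ((Polynomial.aeval t).comp (MvPolynomial.aeval
        (fun j => if j = i then (Polynomial.X : Polynomial ℝ) else Polynomial.C (w j)))) =
        MvPolynomial.aeval (Function.update w i t) := by
      apply MvPolynomial.algHom_ext
      intro j
      by_cases hj : j = i
      · subst hj; simp
      · simp [hj]
    have h2 := DFunLike.congr_fun this Q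
    simpa [hq, Polynomial.coe_aeval_eq_eval, MvPolynomial.aeval_eq_eval] using h2
  have hk : ∀ k ∈ B.filter (fun k => f k = a), ∀ j, j ≠ i → k j = k₀ j := by
    intro k hk j hj
    have := congrFun ((Finset.mem_filter.1 hk).2.trans hk₀a.symm) ⟨j, hj⟩
    exact this
  have hqx : ∀ k ∈ B.filter (fun k => f k = a), 0 < q.eval (k i * s + x i) := by
    intro k hk'
    rw [hqeval]
    have : Function.update w i (k i * s + x i) = fun j => k j * s + x j := by
      funext j
      by_cases hj : j = i
      · subst hj; simp
      · simp [hj, hw, hk k hk' j hj]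
    rw [this]
    exact hBx k (Finset.mem_filter.1 hk').1
  have hqy : ∀ k ∈ B.filter (fun k => f k = a), q.eval (k i * s + y i) ≤ 0 := by
    intro k hk'
    rw [hqeval]
    have : Function.update w i (k i * s + y i) = fun j => k j * s + y j := by
      funext j
      by_cases hj : j = i
      · subst hj; simp
      · simp [hj, hw, hk k hk' j hj, hxy j hj]
    rw [this]
    exact hBy k (Finset.mem_filter.1 hk').1
  have hq0 : q ≠ 0 := by
    intro h
    have := hqx k₀ hk₀
    simp [h] at this
  have hroot : ∀ k ∈ B.filter (fun k => f k = a), ∃ r, q.eval r = 0 ∧ ⌊r / s⌋ = k i := by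
    intro k hk'
    obtain ⟨r, hr, hr0⟩ := intermediate_value_uIcc (f := fun t => q.eval t)
      (a := k i * s + y i) (b := k i * s + x i) q.continuous.continuousOn
      (Set.Icc_subset_uIcc ⟨hqy k hk', (hqx k hk').le⟩)
    refine ⟨r, hr0, ?_⟩
    rw [Int.floor_eq_iff, le_div_iff₀ hs, div_lt_iff₀ hs]
    rcases Set.mem_uIcc.1 hr with h | h <;> constructor <;> nlinarith [h.1, h.2]
  choose! r hr0 hr using hroot
  calc (B.filter fun k => f k = a).card ≤ q.roots.toFinset.card := by
        apply Finset.card_le_card_of_injOn r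
        · intro k hk'
          simpa [hq0] using hr0 k hk'
        · intro k hk' k' hk'' h
          funext j
          by_cases hj : j = i
          · subst hj
            rw [← hr k hk', ← hr k' hk'', h]
          · rw [hk k hk' j hj, hk k' hk'' j hj]
    _ ≤ q.natDegree := (Multiset.toFinset_card_le _).trans (Polynomial.card_roots' q)
    _ ≤ N * 1 := by
        apply MvPolynomial.aeval_natDegree_le Q hQ
        intro j
        split_ifs
        · exact Polynomial.natDegree_X_le
        · simp
    _ = N := mul_one N

/-- A polynomial of degree at most `N` has different signs at two given points relative to the
boxes of a grid in a bounded number of boxes. -/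
lemma card_sign_changes_le {n N m : ℕ} {s : ℝ} (hs : 0 < s) (Q : MvPolynomial (Fin n) ℝ)
    (hQ : Q.totalDegree ≤ N) (x y : Fin n → ℝ)
    (hx : ∀ i, 0 ≤ x i ∧ x i < s) (hy : ∀ i, 0 ≤ y i ∧ y i < s) (B : Finset (Fin n → ℤ))
    (hB : ∀ k ∈ B, ∀ j, 0 ≤ k j ∧ k j < m)
    (hBx : ∀ k ∈ B, 0 < MvPolynomial.eval (fun j => k j * s + x j) Q)
    (hBy : ∀ k ∈ B, MvPolynomial.eval (fun j => k j * s + y j) Q < 0) :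
    B.card ≤ n * (N * m ^ (n - 1)) := by
  classical
  set z : ℕ → Fin n → ℝ := fun i j => if (j : ℕ) < i then y j else x j with hz
  set Bi : Fin n → Finset (Fin n → ℤ) := fun i => B.filter fun k =>
    0 < MvPolynomial.eval (fun j => k j * s + z i j) Q ∧
      MvPolynomial.eval (fun j => k j * s + z (i + 1) j) Q ≤ 0 with hBi
  have hzmem : ∀ i j, 0 ≤ z i j ∧ z i j < s := by
    intro i j
    simp only [hz]
    split_ifs
    · exact hy j
    · exact hx j
  have hcover : B ⊆ Finset.univ.biUnion Bi := by
    intro k hk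
    by_contra hcon
    have hpos : ∀ i ≤ n, 0 < MvPolynomial.eval (fun j => k j * s + z i j) Q := by
      intro i hi
      induction i with
      | zero => simpa [hz] using hBx k hk
      | succ i ih =>
        by_contra h
        apply hcon
        simp only [Finset.mem_biUnion, Finset.mem_univ, true_and, hBi, Finset.mem_filter]
        exact ⟨⟨i, hi⟩, hk, ih (by omega), not_lt.1 h⟩
    have h1 := hpos n le_rfl
    have h2 := hBy k hk
    simp only [hz, Fin.is_lt, if_true] at h1
    exact lt_asymm h1 h2
  refine (Finset.card_le_card hcover).trans ?_
  have := Finset.card_biUnion_le_card_mul Finset.univ Bi (N * m ^ (n - 1)) (fun i _ => by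
    refine card_sign_changes_line_le hs Q hQ i (z i) (z (i + 1)) ?_ (hzmem _ _) (hzmem _ _) (Bi i)
      (fun k hk => hB k (Finset.mem_filter.1 hk).1) (fun k hk => (Finset.mem_filter.1 hk).2.1)
      (fun k hk => (Finset.mem_filter.1 hk).2.2)
    intro j hj
    have : (j : ℕ) ≠ i := fun h => hj (Fin.ext h)
    simp only [hz]
    split_ifs <;> first | rfl | omega)
  simpa using this

lemma gridCube_eq_preimage (n : ℕ) (s : ℝ) (k : Fin n → ℤ) :
    gridCube n s k = WithLp.ofLp ⁻¹'
      (Set.Icc (fun i => (k i : ℝ) * s) (fun i => ((k i : ℝ) + 1) * s)) := by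
  ext x
  simp only [gridCube, Set.mem_ofPred_eq, Set.mem_preimage, Set.mem_Icc, Pi.le_def, forall_and]

lemma measurableSet_gridCube (n : ℕ) (s : ℝ) (k : Fin n → ℤ) :
    MeasurableSet (gridCube n s k) := by
  rw [gridCube_eq_preimage]
  exact (PiLp.volume_preserving_ofLp (Fin n)).measurable measurableSet_Icc

lemma volume_gridCube (n : ℕ) (s : ℝ) (k : Fin n → ℤ) :
    volume (gridCube n s k) = ENNReal.ofReal s ^ n := by
  rw [gridCube_eq_preimage, (PiLp.volume_preserving_ofLp (Fin n)).measure_preimage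
    measurableSet_Icc.nullMeasurableSet, Real.volume_Icc_pi]
  have : ∀ i, ((k i : ℝ) + 1) * s - k i * s = s := fun i => by ring
  simp [this]

lemma volume_gridCube_inter (n : ℕ) (s : ℝ) (k : Fin n → ℤ) (A : Set (Fin n → ℝ))
    (hA : MeasurableSet A) :
    volume {x ∈ gridCube n s k | WithLp.ofLp x ∈ A} =
      volume (Set.Icc (fun i => (k i : ℝ) * s) (fun i => ((k i : ℝ) + 1) * s) ∩ A) := by
  rw [← (PiLp.volume_preserving_ofLp (Fin n)).measure_preimage
    (measurableSet_Icc.inter hA).nullMeasurableSet, Set.preimage_inter, ← gridCube_eq_preimage]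
  rfl

/-- The part of a grid cube in `A`, moved to the half-open box at the origin. -/
lemma volume_box_inter_translate (n : ℕ) (s : ℝ) (k : Fin n → ℤ) (A : Set (Fin n → ℝ))
    (hA : MeasurableSet A) :
    volume {x : Fin n → ℝ | x ∈ Set.pi Set.univ (fun _ => Set.Ico 0 s) ∧
        (fun j => k j * s + x j) ∈ A} =
      volume {x ∈ gridCube n s k | WithLp.ofLp x ∈ A} := by
  rw [volume_gridCube_inter n s k A hA]
  have hae : ((Set.pi Set.univ fun i => Set.Ico ((k i : ℝ) * s) (((k i : ℝ) + 1) * s)) ∩ A :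
      Set (Fin n → ℝ)) =ᵐ[volume]
      (Set.Icc (fun i => (k i : ℝ) * s) (fun i => ((k i : ℝ) + 1) * s) ∩ A : Set (Fin n → ℝ)) :=
    ae_eq_set_inter Measure.univ_pi_Ico_ae_eq_Icc (Filter.EventuallyEq.refl _ _)
  rw [← measure_congr hae,
    ← measure_preimage_add volume (fun j => (k j : ℝ) * s) (_ ∩ A)]
  congr 1
  ext x
  simp only [Set.mem_ofPred_eq, Set.mem_pi, Set.mem_univ, true_imp_iff, Set.mem_preimage,
    Set.mem_inter_iff, Set.mem_Ico, Pi.add_apply]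
  refine and_congr (forall_congr' fun i => ?_) Iff.rfl
  constructor <;> rintro ⟨h₁, h₂⟩ <;> constructor <;> linarith

/-- The number of grid cubes which are roughly bisected by a polynomial of degree at most `N`. -/
lemma card_roughlyBisected_le {n N m : ℕ} {s : ℝ} (hs : 0 < s) (Q : MvPolynomial (Fin n) ℝ)
    (hQ : Q.totalDegree ≤ N) (T : Finset (Fin n → ℤ))
    (hT : ∀ k ∈ T, ∀ j, 0 ≤ k j ∧ k j < m)
    (hTQ : ∀ k ∈ T, RoughlyBisected Q (gridCube n s k)) :
    T.card ≤ 100 * (n * (N * m ^ (n - 1))) := by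
  set U : Set (Fin n → ℝ) := Set.pi Set.univ (fun _ => Set.Ico 0 s) with hU
  set A : Set (Fin n → ℝ) := {y | 0 < MvPolynomial.eval y Q} with hA
  set B : Set (Fin n → ℝ) := {y | MvPolynomial.eval y Q < 0} with hB
  have hAm : MeasurableSet A :=
    (isOpen_lt continuous_const (MvPolynomial.continuous_eval Q)).measurableSet
  have hBm : MeasurableSet B :=
    (isOpen_lt (MvPolynomial.continuous_eval Q) continuous_const).measurableSet
  have hUm : MeasurableSet U := MeasurableSet.univ_pi fun _ => measurableSet_Ico
  have hshift : ∀ k : Fin n → ℤ, Measurable fun (x : Fin n → ℝ) j => (k j : ℝ) * s + x j := by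
    intro k; fun_prop
  set EA : (Fin n → ℤ) → Set (Fin n → ℝ) := fun k => {x | x ∈ U ∧ (fun j => k j * s + x j) ∈ A}
  set EB : (Fin n → ℤ) → Set (Fin n → ℝ) := fun k => {x | x ∈ U ∧ (fun j => k j * s + x j) ∈ B}
  have hEAm : ∀ k, MeasurableSet (EA k) := fun k => hUm.inter (hshift k hAm)
  have hEBm : ∀ k, MeasurableSet (EB k) := fun k => hUm.inter (hshift k hBm)
  set V : ℝ≥0∞ := ENNReal.ofReal s ^ n with hV
  have hV0 : V ≠ 0 := pow_ne_zero _ (by simpa using hs)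
  have hVt : V ≠ ∞ := ENNReal.pow_ne_top ENNReal.ofReal_ne_top
  have hUvol : volume U = V := by
    rw [hU, hV, volume_pi_pi]
    simp
  have hEA : ∀ k ∈ T, 10⁻¹ * V ≤ volume (EA k) := by
    intro k hk
    have h := (hTQ k hk).1
    rw [volume_gridCube] at h
    exact h.trans_eq (volume_box_inter_translate n s k A hAm).symm
  have hEB : ∀ k ∈ T, 10⁻¹ * V ≤ volume (EB k) := by
    intro k hk
    have h := (hTQ k hk).2
    rw [volume_gridCube] at h
    exact h.trans_eq (volume_box_inter_translate n s k B hBm).symm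
  have hsum := sum_measure_le_of_overlap (volume : Measure ((Fin n → ℝ) × (Fin n → ℝ))) T
    (fun k => EA k ×ˢ EB k) (U ×ˢ U) (fun k _ => (hEAm k).prod (hEBm k)) (hUm.prod hUm)
    (fun k _ => Set.prod_mono (fun _ h => h.1) (fun _ h => h.1)) (n * (N * m ^ (n - 1))) (by
      rintro ⟨x, y⟩ ⟨hx, hy⟩ C hC hCE
      exact card_sign_changes_le hs Q hQ x y (fun i => hx i trivial) (fun i => hy i trivial) C
        (fun k hk => hT k (hC hk)) (fun k hk => (hCE k hk).1.2) (fun k hk => (hCE k hk).2.2))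
  have hlow : (T.card : ℝ≥0∞) * (10⁻¹ * V * (10⁻¹ * V)) ≤
      (n * (N * m ^ (n - 1)) : ℕ) * (V * V) := by
    calc (T.card : ℝ≥0∞) * (10⁻¹ * V * (10⁻¹ * V))
        = ∑ k ∈ T, (10⁻¹ * V * (10⁻¹ * V)) := by simp
      _ ≤ ∑ k ∈ T, volume (EA k ×ˢ EB k) := by
          refine Finset.sum_le_sum fun k hk => ?_
          rw [Measure.volume_eq_prod, Measure.prod_prod]
          exact mul_le_mul' (hEA k hk) (hEB k hk)
      _ ≤ _ := by
          refine hsum.trans_eq ?_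
          rw [Measure.volume_eq_prod, Measure.prod_prod, hUvol]
  have hVV0 : V * V ≠ 0 := mul_ne_zero hV0 hV0
  have hVVt : V * V ≠ ∞ := ENNReal.mul_ne_top hVt hVt
  have h10 : (10 : ℝ≥0∞)⁻¹ * 10⁻¹ * 100 = 1 := by
    rw [← ENNReal.mul_inv (by simp) (by simp), show (10 : ℝ≥0∞) * 10 = 100 by norm_num]
    exact ENNReal.inv_mul_cancel (by simp) (by simp)
  have hfinal : (T.card : ℝ≥0∞) * (V * V) ≤ (100 * (n * (N * m ^ (n - 1))) : ℕ) * (V * V) := by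
    calc (T.card : ℝ≥0∞) * (V * V)
        = 100 * ((T.card : ℝ≥0∞) * (10⁻¹ * V * (10⁻¹ * V))) := by
          rw [show 100 * ((T.card : ℝ≥0∞) * (10⁻¹ * V * (10⁻¹ * V))) =
            (10⁻¹ * 10⁻¹ * 100) * ((T.card : ℝ≥0∞) * (V * V)) by ring, h10, one_mul]
      _ ≤ 100 * ((n * (N * m ^ (n - 1)) : ℕ) * (V * V)) := by gcongr
      _ = _ := by push_cast; ring
  exact_mod_cast (ENNReal.mul_le_mul_iff_left hVV0 hVVt).1 hfinal

end Counting

section Grid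

lemma gridCube_subset_unitCube_iff {n : ℕ} {s : ℝ} (hs : 0 < s) (k : Fin n → ℤ) :
    gridCube n s k ⊆ unitCube n ↔ ∀ i, 0 ≤ (k i : ℝ) * s ∧ ((k i : ℝ) + 1) * s ≤ 1 := by
  constructor
  · intro h i
    have h₁ : WithLp.toLp 2 (fun i => (k i : ℝ) * s) ∈ gridCube n s k := by
      intro j
      simp only [Set.mem_Icc]
      constructor <;> linarith
    have h₂ : WithLp.toLp 2 (fun i => ((k i : ℝ) + 1) * s) ∈ gridCube n s k := by
      intro j
      simp only [Set.mem_Icc]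
      constructor <;> linarith
    exact ⟨(h h₁ i).1, (h h₂ i).2⟩
  · intro h x hx i
    exact ⟨(h i).1.trans (hx i).1, (hx i).2.trans (h i).2⟩

lemma index_nonneg_lt_of_gridCube_subset {n : ℕ} {s : ℝ} (hs : 0 < s) {k : Fin n → ℤ}
    (hk : gridCube n s k ⊆ unitCube n) (i : Fin n) : 0 ≤ k i ∧ k i < (⌊1 / s⌋₊ : ℕ) := by
  obtain ⟨h₁, h₂⟩ := (gridCube_subset_unitCube_iff hs k).1 hk i
  have h₃ : 0 ≤ k i := by
    have : (0 : ℝ) ≤ k i := nonneg_of_mul_nonneg_left h₁ hs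
    exact_mod_cast this
  refine ⟨h₃, ?_⟩
  have h₄ : (((k i).toNat + 1 : ℕ) : ℝ) ≤ 1 / s := by
    rw [le_div_iff₀ hs]
    have : (((k i).toNat : ℤ) : ℝ) = k i := by rw [Int.toNat_of_nonneg h₃]
    push_cast at this ⊢
    rwa [this]
  have := Nat.le_floor h₄
  omega

lemma finite_gridCube_subset_unitCube {n : ℕ} {s : ℝ} (hs : 0 < s) :
    {k : Fin n → ℤ | gridCube n s k ⊆ unitCube n}.Finite := by
  refine (Set.Finite.pi (t := fun _ : Fin n => Set.Ico (0 : ℤ) (⌊1 / s⌋₊ : ℕ))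
    fun _ => Set.finite_Ico _ _).subset fun k hk i _ => ?_
  exact index_nonneg_lt_of_gridCube_subset hs hk i

/-- Grid cubes overlap only on a null set. -/
lemma card_mul_le_volume_biUnion_gridCube {n : ℕ} {s : ℝ} (hs : 0 < s)
    (S : Finset (Fin n → ℤ)) :
    (S.card : ℝ≥0∞) * ENNReal.ofReal s ^ n ≤ volume (⋃ k ∈ S, gridCube n s k) := by
  set E : (Fin n → ℤ) → Set (Fin n → ℝ) := fun k =>
    Set.pi Set.univ fun i => Set.Ico ((k i : ℝ) * s) (((k i : ℝ) + 1) * s) with hE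
  have hEm : ∀ k, MeasurableSet (E k) := fun k => MeasurableSet.univ_pi fun _ => measurableSet_Ico
  have hmp := PiLp.volume_preserving_ofLp (Fin n)
  have hvol : ∀ k, volume (WithLp.ofLp ⁻¹' E k : Set (EuclideanSpace ℝ (Fin n))) =
      ENNReal.ofReal s ^ n := by
    intro k
    rw [hmp.measure_preimage (hEm k).nullMeasurableSet, hE, volume_pi_pi]
    have : ∀ i, ((k i : ℝ) + 1) * s - k i * s = s := fun i => by ring
    simp [this]
  have h := sum_measure_le_of_overlap (volume : Measure (EuclideanSpace ℝ (Fin n))) S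
    (fun k => WithLp.ofLp ⁻¹' E k) (⋃ k ∈ S, gridCube n s k) (fun k _ => hmp.measurable (hEm k))
    (S.measurableSet_biUnion fun k _ => measurableSet_gridCube n s k) (by
      intro k hk x hx
      refine Set.mem_biUnion hk fun i => ?_
      have := hx i trivial
      exact ⟨this.1, this.2.le⟩) 1 (by
      intro p _ B _ hB
      refine Finset.card_le_one.2 fun k hk k' hk' => funext fun i => ?_
      have hfloor : ∀ k ∈ B, ⌊p i / s⌋ = k i := by
        intro k hk
        have := hB k hk i trivial
        rw [Int.floor_eq_iff, le_div_iff₀ hs, div_lt_iff₀ hs]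
        exact this
      rw [← hfloor k hk, ← hfloor k' hk'])
  simpa [hvol] using h

lemma mem_gridCube_floor {n : ℕ} {s : ℝ} (hs : 0 < s) (y : EuclideanSpace ℝ (Fin n)) :
    y ∈ gridCube n s fun i => ⌊y i / s⌋ := by
  intro i
  have h₁ := Int.floor_le (y i / s)
  have h₂ := (Int.lt_floor_add_one (y i / s)).le
  rw [le_div_iff₀ hs] at h₁
  rw [div_le_iff₀ hs] at h₂
  exact ⟨h₁, h₂⟩

/-- A line of unit speed stays in a grid cube of side `s` for a time of at most `n * s`. -/
lemma dist_le_of_mem_gridCube {n : ℕ} {s : ℝ} {k : Fin n → ℤ}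
    {x v : EuclideanSpace ℝ (Fin n)} (hv : ‖v‖ = 1) {t t' : ℝ}
    (ht : x + t • v ∈ gridCube n s k) (ht' : x + t' • v ∈ gridCube n s k) :
    |t - t'| ≤ n * s := by
  have hcoord : ∀ i, |(t - t') * v i| ≤ s := by
    intro i
    obtain ⟨h₁, h₂⟩ := ht i
    obtain ⟨h₃, h₄⟩ := ht' i
    simp only [PiLp.add_apply, PiLp.smul_apply, smul_eq_mul] at h₁ h₂ h₃ h₄
    rw [abs_le]
    constructor <;> linarith
  have hsum : |t - t'| = ‖(t - t') • v‖ := by rw [norm_smul, hv, mul_one, Real.norm_eq_abs]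
  have hle : ‖(t - t') • v‖ ≤ ∑ i, |(t - t') * v i| := by
    have : (t - t') • v = ∑ i, EuclideanSpace.single i ((t - t') * v i) := by
      ext j
      simp [Finset.sum_apply, Pi.single_apply]
    rw [this]
    refine (norm_sum_le _ _).trans (Finset.sum_le_sum fun i _ => ?_)
    simp
  rw [hsum]
  refine hle.trans ((Finset.sum_le_sum fun i _ => hcoord i).trans ?_)
  simp

/-- If `D` is such that no polynomial of degree at most `D` is singular in all directions, then a
set with a long intersection with lines in all directions meets many grid cubes. -/
lemma pow_le_card_of_not_isSingularDir {n D : ℕ} (hn : 0 < n) {δ ε : ℝ} (hδ : 0 < δ)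
    (hD : 0 < D) (hD2 : (D : ℝ) ^ (-(1 + ε)) ≤ 1 / 2)
    (hA : ∀ Q : MvPolynomial (Fin n) ℝ, Q ≠ 0 → Q.totalDegree ≤ D →
      ∃ v : EuclideanSpace ℝ (Fin n), ‖v‖ = 1 ∧ ¬ IsSingularDir D ε (2 * n / δ) Q v)
    {P : Set (EuclideanSpace ℝ (Fin n))} (hP : P ⊆ unitCube n)
    (hPv : ∀ v : EuclideanSpace ℝ (Fin n), ‖v‖ = 1 →
      ∃ x : EuclideanSpace ℝ (Fin n), ENNReal.ofReal δ ≤ volume {t : ℝ | x + t • v ∈ P})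
    (T : Finset (Fin n → ℤ))
    (hT : ∀ k ∈ T, ∃ y ∈ P, k = fun i => ⌊y i / 2 / (D : ℝ) ^ (-(1 + ε))⌋)
    (hPT : ∀ y ∈ P, (fun i => ⌊y i / 2 / (D : ℝ) ^ (-(1 + ε))⌋) ∈ T) :
    (D / n + 1) ^ n ≤ T.card := by
  classical
  have hD0 : (0 : ℝ) < D := by exact_mod_cast hD
  set s : ℝ := (D : ℝ) ^ (-(1 + ε)) with hs_def
  have hs : 0 < s := Real.rpow_pos_of_pos hD0 _
  have hs_inv : (D : ℝ) ^ (1 + ε) = s⁻¹ := by rw [hs_def, Real.rpow_neg hD0.le, inv_inv]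
  have hn0 : (0 : ℝ) < n := by exact_mod_cast hn
  by_contra! hcard
  let e := T.equivFin
  obtain ⟨Q, hQ0, hQD, hQ⟩ := exists_polynomial_bisecting hcard
    (fun j => Set.Icc (fun i => (((e.symm j : Fin n → ℤ) i : ℤ) : ℝ) * s)
      (fun i => ((((e.symm j : Fin n → ℤ) i : ℤ) : ℝ) + 1) * s))
    (fun j => (isCompact_Icc.measure_lt_top).ne)
  have hbis : ∀ k ∈ T, RoughlyBisected Q (gridCube n s k) := by
    intro k hk
    have h := hQ (e ⟨k, hk⟩)
    rw [Equiv.symm_apply_apply] at h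
    have hvol : volume (gridCube n s k) =
        volume (Set.Icc (fun i => (k i : ℝ) * s) (fun i => ((k i : ℝ) + 1) * s)) := by
      have := volume_gridCube_inter n s k Set.univ MeasurableSet.univ
      simpa using this
    have hten : (10 : ℝ≥0∞)⁻¹ * volume (gridCube n s k) ≤ volume (gridCube n s k) / 2 := by
      rw [ENNReal.div_eq_inv_mul]
      gcongr
      norm_num
    rw [← hvol] at h
    constructor
    · refine (hten.trans h.1).trans_eq (volume_gridCube_inter n s k _ ?_).symm
      exact (isOpen_lt continuous_const (MvPolynomial.continuous_eval Q)).measurableSet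
    · refine (hten.trans h.2).trans_eq (volume_gridCube_inter n s k _ ?_).symm
      exact (isOpen_lt (MvPolynomial.continuous_eval Q) continuous_const).measurableSet
  have hsub : ∀ k ∈ T, gridCube n s k ⊆ unitCube n := by
    intro k hk
    obtain ⟨y, hy, rfl⟩ := hT k hk
    rw [gridCube_subset_unitCube_iff hs]
    intro i
    obtain ⟨h₁, h₂⟩ := hP hy i
    have h₃ := Int.floor_le (y i / 2 / s)
    rw [le_div_iff₀ hs] at h₃
    have h₄ : (0 : ℤ) ≤ ⌊y i / 2 / s⌋ := Int.floor_nonneg.2 (by positivity)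
    have h₅ : (0 : ℝ) ≤ ⌊y i / 2 / s⌋ := by exact_mod_cast h₄
    exact ⟨by positivity, by linarith⟩
  obtain ⟨v, hv, hns⟩ := hA Q hQ0 hQD
  apply hns
  obtain ⟨x, hx⟩ := hPv v hv
  refine ⟨(1 / 2 : ℝ) • x, ?_⟩
  rw [hs_inv]
  set F := T.filter fun k => (gridCube n s k ∩ {y | ∃ t : ℝ, y = (1 / 2 : ℝ) • x + t • v}).Nonempty
    with hF
  have hcover : {t : ℝ | x + t • v ∈ P} ⊆
      ⋃ k ∈ F, {t : ℝ | (1 / 2 : ℝ) • x + (t / 2) • v ∈ gridCube n s k} := by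
    intro t ht
    have hmem := hPT _ ht
    have hcube := mem_gridCube_floor hs ((1 / 2 : ℝ) • x + (t / 2) • v)
    have heq : ∀ i, ((1 / 2 : ℝ) • x + (t / 2) • v) i = (x + t • v) i / 2 := by
      intro i
      simp only [PiLp.add_apply, PiLp.smul_apply, smul_eq_mul]
      ring
    simp only [heq] at hcube
    exact Set.mem_biUnion (Finset.mem_filter.2 ⟨hmem, _, hcube, t / 2, rfl⟩) hcube
  have hlen : ∀ k, volume {t : ℝ | (1 / 2 : ℝ) • x + (t / 2) • v ∈ gridCube n s k} ≤
      ENNReal.ofReal (2 * n * s) := by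
    intro k
    refine (Real.volume_le_diam _).trans (Metric.ediam_le fun t ht t' ht' => ?_)
    rw [edist_dist]
    refine ENNReal.ofReal_le_ofReal ?_
    have := dist_le_of_mem_gridCube hv ht ht'
    rw [Real.dist_eq]
    rw [← sub_div, abs_div, abs_two] at this
    linarith
  have hδF : δ ≤ F.card * (2 * n * s) := by
    have h : ENNReal.ofReal δ ≤ F.card * ENNReal.ofReal (2 * n * s) :=
      calc ENNReal.ofReal δ ≤ volume {t : ℝ | x + t • v ∈ P} := hx
        _ ≤ ∑ k ∈ F, volume {t : ℝ | (1 / 2 : ℝ) • x + (t / 2) • v ∈ gridCube n s k} :=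
            (measure_mono hcover).trans (measure_biUnion_finset_le _ _)
        _ ≤ ∑ k ∈ F, ENNReal.ofReal (2 * n * s) := Finset.sum_le_sum fun k _ => hlen k
        _ = _ := by simp
    rw [← ENNReal.ofReal_natCast, ← ENNReal.ofReal_mul (by positivity)] at h
    exact (ENNReal.ofReal_le_ofReal_iff (by positivity)).1 h
  calc (2 * n / δ)⁻¹ * s⁻¹ = δ / (2 * n * s) := by field_simp
    _ ≤ F.card := by rwa [div_le_iff₀ (by positivity)]
    _ ≤ _ := by
      rw [← Set.ncard_coe_finset]
      refine Nat.cast_le.2 (Set.ncard_le_ncard ?_ ?_)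
      · intro k hk
        obtain ⟨hkT, hk⟩ := Finset.mem_filter.1 (Finset.mem_coe.1 hk)
        exact ⟨hsub k hkT, hbis k hkT, hk⟩
      · exact (finite_gridCube_subset_unitCube hs).subset fun k hk => hk.1

/-- The points of a union of grid cubes, scaled by one half, lie in boundedly many cubes of a
coarser grid. -/
lemma exists_finset_floor_half {n : ℕ} {r s : ℝ} (hr : 0 < r) (hrs : r ≤ s)
    (S : Finset (Fin n → ℤ)) {P : Set (EuclideanSpace ℝ (Fin n))}
    (hP : P = ⋃ k ∈ S, gridCube n r k) :
    ∃ T : Finset (Fin n → ℤ), T.card ≤ 2 ^ n * S.card ∧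
      (∀ k ∈ T, ∃ y ∈ P, k = fun i => ⌊y i / 2 / s⌋) ∧
      ∀ y ∈ P, (fun i => ⌊y i / 2 / s⌋) ∈ T := by
  classical
  have hs : 0 < s := hr.trans_le hrs
  refine ⟨(S.biUnion fun k => Fintype.piFinset fun i =>
    Finset.Icc ⌊k i * r / 2 / s⌋ (⌊k i * r / 2 / s⌋ + 1)).filter
      fun k => ∃ y ∈ P, k = fun i => ⌊y i / 2 / s⌋, ?_, ?_, ?_⟩
  · refine (Finset.card_le_card (Finset.filter_subset _ _)).trans ?_
    refine (Finset.card_biUnion_le_card_mul _ _ (2 ^ n) fun k _ => ?_).trans_eq (mul_comm _ _)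
    rw [Fintype.card_piFinset]
    simp [add_assoc]
  · exact fun k hk => (Finset.mem_filter.1 hk).2
  · intro y hy
    refine Finset.mem_filter.2 ⟨?_, y, hy, rfl⟩
    rw [hP] at hy
    obtain ⟨k, hk, hyk⟩ := Set.mem_iUnion₂.1 hy
    refine Finset.mem_biUnion.2 ⟨k, hk, Fintype.mem_piFinset.2 fun i => Finset.mem_Icc.2 ?_⟩
    obtain ⟨h₁, h₂⟩ := hyk i
    constructor
    · exact Int.floor_le_floor (by gcongr)
    · rw [← Int.floor_add_one]
      refine Int.floor_le_floor ?_
      rw [div_add_one hs.ne']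
      gcongr
      linarith

end Grid

section Equivalence

/-- Grid cubes of side `s`, scaled by one half into the middle of the unit cube, can be covered by
boundedly many cubes of a grid of comparable side so that each line meeting some of the given cubes
has a parallel line which has a long intersection with the covering cubes. -/
lemma exists_finset_gridCube_of_line {n M : ℕ} {s : ℝ} (hs : 0 < s) (hs4 : s < 1 / 4) (hM : 0 < M)
    (hsM : s ≤ 1 / M) (T : Finset (Fin n → ℤ)) (hT : ∀ k ∈ T, gridCube n s k ⊆ unitCube n) :
    ∃ S : Finset (Fin n → ℤ), S.card ≤ 4 ^ n * T.card ∧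
      (∀ k ∈ S, gridCube n (1 / M) k ⊆ unitCube n) ∧
      ∀ x v : EuclideanSpace ℝ (Fin n), ‖v‖ = 1 → ∀ F ⊆ T,
        (∀ k ∈ F, (gridCube n s k ∩ {y | ∃ t : ℝ, y = x + t • v}).Nonempty) →
        ∃ x' : EuclideanSpace ℝ (Fin n), ENNReal.ofReal (F.card * (2 * s)) ≤
          (6 ^ n : ℕ) * volume {t : ℝ | x' + t • v ∈ ⋃ k ∈ S, gridCube n (1 / M) k} := by
  classical
  have hM0 : (0 : ℝ) < M := by exact_mod_cast hM
  set r : ℝ := 1 / M with hr_def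
  have hr : 0 < r := by positivity
  have hMr : (M : ℝ) * r = 1 := by rw [hr_def]; field_simp
  set a : (Fin n → ℤ) → Fin n → ℤ := fun j i => ⌊(j i * s / 2 + 1 / 4 - s) / r⌋ with ha
  refine ⟨(T.biUnion fun j => Fintype.piFinset fun i => Finset.Icc (a j i) (a j i + 3)).filter
    fun k => gridCube n r k ⊆ unitCube n, ?_, fun k hk => (Finset.mem_filter.1 hk).2, ?_⟩
  · refine (Finset.card_le_card (Finset.filter_subset _ _)).trans ?_
    refine (Finset.card_biUnion_le_card_mul _ _ (4 ^ n) fun k _ => ?_).trans_eq (mul_comm _ _)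
    rw [Fintype.card_piFinset]
    simp [add_assoc]
  intro x v hv F hFT hF
  have hv1 : ∀ i, |v i| ≤ 1 := fun i => by
    have := PiLp.norm_apply_le v i
    rwa [hv, Real.norm_eq_abs] at this
  have hF' : ∀ k ∈ F, ∃ t : ℝ, x + t • v ∈ gridCube n s k := by
    intro k hk
    obtain ⟨y, hy, t, rfl⟩ := hF k hk
    exact ⟨t, hy⟩
  choose! τ hτ using hF'
  have hτi : ∀ k ∈ F, ∀ i, k i * s ≤ x i + τ k * v i ∧ x i + τ k * v i ≤ (k i + 1) * s := by
    intro k hk i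
    have := hτ k hk i
    simpa only [PiLp.add_apply, PiLp.smul_apply, smul_eq_mul, Set.mem_Icc] using this
  have hmul : ∀ (u : ℝ) {b : ℝ}, |u| ≤ b → ∀ i, -b ≤ u * v i ∧ u * v i ≤ b := by
    intro u b hu i
    rw [← abs_le, abs_mul]
    exact (mul_le_of_le_one_right (abs_nonneg u) (hv1 i)).trans hu
  set x' : EuclideanSpace ℝ (Fin n) := WithLp.toLp 2 fun i => x i / 2 + 1 / 4 with hx'
  refine ⟨x', ?_⟩
  set P := ⋃ k ∈ (T.biUnion fun j => Fintype.piFinset fun i =>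
    Finset.Icc (a j i) (a j i + 3)).filter fun k => gridCube n r k ⊆ unitCube n, gridCube n r k
    with hP
  have hPm : MeasurableSet P :=
    Finset.measurableSet_biUnion _ fun k _ => measurableSet_gridCube n r k
  have hsub : ∀ k ∈ F, Set.Icc (τ k / 2 - s) (τ k / 2 + s) ⊆ {t : ℝ | x' + t • v ∈ P} := by
    intro k hk t ht
    have habs : |t - τ k / 2| ≤ s := by
      rw [abs_le]
      constructor <;> linarith [ht.1, ht.2]
    have hcoord : ∀ i, (x' + t • v) i = x i / 2 + 1 / 4 + t * v i := fun i => by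
      simp [hx']
    have hlow : ∀ i, k i * s / 2 + 1 / 4 - s ≤ (x' + t • v) i := by
      intro i
      rw [hcoord]
      linarith [hτi k hk i, hmul _ habs i]
    have hhigh : ∀ i, (x' + t • v) i ≤ (k i * s / 2 + 1 / 4 - s) + 5 / 2 * s := by
      intro i
      rw [hcoord]
      linarith [hτi k hk i, hmul _ habs i]
    refine Set.mem_biUnion (Finset.mem_filter.2 ⟨Finset.mem_biUnion.2 ⟨k, hFT hk,
      Fintype.mem_piFinset.2 fun i => Finset.mem_Icc.2 ⟨?_, ?_⟩⟩, ?_⟩) (mem_gridCube_floor hr _)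
    · exact Int.floor_le_floor (by gcongr; exact hlow i)
    · rw [show a k i + 3 = ⌊(k i * s / 2 + 1 / 4 - s) / r + 3⌋ by
        rw [ha]; exact (Int.floor_add_ofNat _ _).symm]
      refine Int.floor_le_floor ?_
      rw [div_add' _ _ _ hr.ne']
      gcongr
      linarith [hhigh i]
    · rw [gridCube_subset_unitCube_iff hr]
      intro i
      obtain ⟨h₁, h₂⟩ := (gridCube_subset_unitCube_iff hs k).1 (hT k (hFT hk)) i
      have h₃ : 0 ≤ (x' + t • v) i := by linarith [hlow i]
      have h₄ : (x' + t • v) i < M * r := by rw [hMr]; linarith [hhigh i]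
      have h₅ : (0 : ℝ) ≤ ⌊(x' + t • v) i / r⌋ := by
        exact_mod_cast Int.floor_nonneg.2 (by positivity)
      have h₆ : ⌊(x' + t • v) i / r⌋ < (M : ℤ) := by
        rw [Int.floor_lt, div_lt_iff₀ hr]
        exact_mod_cast h₄
      have h₇ : (⌊(x' + t • v) i / r⌋ : ℝ) + 1 ≤ M := by exact_mod_cast h₆
      refine ⟨by positivity, ?_⟩
      exact (mul_le_mul_of_nonneg_right h₇ hr.le).trans_eq hMr
  have h := sum_measure_le_of_overlap (volume : Measure ℝ) F
    (fun k => Set.Icc (τ k / 2 - s) (τ k / 2 + s)) {t : ℝ | x' + t • v ∈ P}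
    (fun k _ => measurableSet_Icc)
    ((by fun_prop : Measurable fun t : ℝ => x' + t • v) hPm) hsub (6 ^ n) (by
    intro p _ B hB hpB
    set c : Fin n → ℤ := fun i => ⌊(x i + 2 * p * v i) / s⌋ with hc
    have hsubset : B ⊆ Fintype.piFinset fun i => Finset.Icc (c i - 3) (c i + 2) := by
      intro k hk
      refine Fintype.mem_piFinset.2 fun i => Finset.mem_Icc.2 ?_
      have habs : |2 * p - τ k| ≤ 2 * s := by
        have := hpB k hk
        rw [abs_le]
        constructor <;> linarith [this.1, this.2]
      have h₁ := hmul _ habs i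
      have h₂ := hτi k (hB hk) i
      have h₃ := Int.floor_le ((x i + 2 * p * v i) / s)
      have h₄ := Int.lt_floor_add_one ((x i + 2 * p * v i) / s)
      rw [le_div_iff₀ hs] at h₃
      rw [div_lt_iff₀ hs] at h₄
      have h₅ : ((c i - 3 : ℤ) : ℝ) ≤ k i := by
        push_cast
        refine le_of_mul_le_mul_right ?_ hs
        linarith
      have h₆ : (k i : ℝ) < (c i + 3 : ℤ) := by
        push_cast
        refine lt_of_mul_lt_mul_right ?_ hs.le
        linarith
      have h₇ : c i - 3 ≤ k i := by exact_mod_cast h₅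
      have h₈ : k i < c i + 3 := by exact_mod_cast h₆
      omega
    refine (Finset.card_le_card hsubset).trans_eq ?_
    rw [Fintype.card_piFinset]
    have : ∀ i, (c i + 2 + 1 - (c i - 3)).toNat = 6 := fun i => by omega
    simp [this])
  refine le_trans (le_of_eq ?_) h
  have : ∀ k, τ k / 2 + s - (τ k / 2 - s) = 2 * s := fun k => by ring
  simp only [Real.volume_Icc, this, Finset.sum_const, nsmul_eq_mul]
  rw [ENNReal.ofReal_mul (by positivity), ENNReal.ofReal_natCast]

lemma volume_biUnion_gridCube_le {n : ℕ} (s : ℝ) (S : Finset (Fin n → ℤ)) :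
    volume (⋃ k ∈ S, gridCube n s k) ≤ S.card * ENNReal.ofReal s ^ n := by
  refine (measure_biUnion_finset_le _ _).trans_eq ?_
  simp [volume_gridCube]

/-- The cube Kakeya estimate follows from the existence of nonsingular directions. -/
lemma volume_lower_bound_of_not_isSingularDir {n : ℕ} (hn : 0 < n)
    (hA : ∀ ε : ℝ, 0 < ε → ∀ H : ℝ, 0 < H → ∃ N₀ : ℕ, ∀ N : ℕ, N₀ ≤ N →
      ∀ Q : MvPolynomial (Fin n) ℝ, Q ≠ 0 → Q.totalDegree ≤ N →
        ∃ v : EuclideanSpace ℝ (Fin n), ‖v‖ = 1 ∧ ¬ IsSingularDir N ε H Q v)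
    {δ ε : ℝ} (hδ : 0 < δ) (hε : 0 < ε) :
    ∃ c : ℝ, 0 < c ∧ ∀ N : ℕ, 0 < N → ∀ S : Finset (Fin n → ℤ),
      (∀ k ∈ S, gridCube n (1 / N) k ⊆ unitCube n) →
      (∀ v : EuclideanSpace ℝ (Fin n), ‖v‖ = 1 → ∃ x : EuclideanSpace ℝ (Fin n),
        ENNReal.ofReal δ ≤ volume {t : ℝ | x + t • v ∈ ⋃ k ∈ S, gridCube n (1 / N) k}) →
      c * (N : ℝ) ^ (-ε) ≤ S.card * (1 / N : ℝ) ^ n := by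
  have hn0 : (0 : ℝ) < n := by exact_mod_cast hn
  set η : ℝ := ε / n with hη_def
  have hη : 0 < η := by positivity
  obtain ⟨N₀, hN₀⟩ := hA η hη (2 * n / δ) (by positivity)
  set M₀ : ℝ := (max N₀ 2 : ℕ) ^ (1 + η) with hM₀
  have hM₀pos : 0 < M₀ := Real.rpow_pos_of_pos (by positivity) _
  refine ⟨min ((4 * n : ℝ)⁻¹ ^ n) (M₀⁻¹ ^ n), by positivity, fun N hN S hS hSv => ?_⟩
  have hN0 : (0 : ℝ) < N := by exact_mod_cast hN
  have hN1 : (1 : ℝ) ≤ N := by exact_mod_cast hN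
  have hr : (0 : ℝ) < 1 / N := by positivity
  have hNε : (0 : ℝ) ≤ (N : ℝ) ^ (-ε) := by positivity
  set X : ℝ := (N : ℝ) ^ (1 + η)⁻¹ with hX
  have hX1 : 1 ≤ X := Real.one_le_rpow hN1 (by positivity)
  have hXN : X ^ (1 + η) = N := by
    rw [hX, ← Real.rpow_mul hN0.le, inv_mul_cancel₀ (by positivity), Real.rpow_one]
  rcases lt_or_ge ⌊X⌋₊ (max N₀ 2) with hsmall | hlarge
  · have hSne : 1 ≤ S.card := by
      rw [Nat.one_le_iff_ne_zero]
      intro hS0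
      obtain ⟨x, hx⟩ := hSv (EuclideanSpace.single ⟨0, hn⟩ 1) (by simp)
      rw [Finset.card_eq_zero] at hS0
      simp [hS0] at hx
      linarith
    have hXlt : X < (max N₀ 2 : ℕ) := (Nat.floor_lt (by positivity)).1 hsmall
    have hNM : (N : ℝ) ≤ M₀ := by
      rw [← hXN]
      exact Real.rpow_le_rpow (by positivity) hXlt.le (by positivity)
    calc min ((4 * n : ℝ)⁻¹ ^ n) (M₀⁻¹ ^ n) * (N : ℝ) ^ (-ε)
        ≤ M₀⁻¹ ^ n * 1 := by
          gcongr
          · exact min_le_right _ _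
          · exact Real.rpow_le_one_of_one_le_of_nonpos hN1 (by linarith)
      _ = 1 * (M₀⁻¹) ^ n := by ring
      _ ≤ S.card * (1 / N : ℝ) ^ n := by
          rw [one_div]
          gcongr
          exact_mod_cast hSne
  · set D := ⌊X⌋₊ with hD
    have hD2 : 2 ≤ D := (le_max_right _ _).trans hlarge
    have hD2' : (2 : ℝ) ≤ D := by exact_mod_cast hD2
    have hD0 : (0 : ℝ) < D := by linarith
    have hDX : (D : ℝ) ≤ X := Nat.floor_le (by positivity)
    have hXD : X ≤ 2 * D := by
      have := Nat.lt_floor_add_one X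
      rw [← hD] at this
      linarith
    have hshalf : (D : ℝ) ^ (-(1 + η)) ≤ 1 / 2 := by
      rw [Real.rpow_neg hD0.le, one_div]
      refine inv_anti₀ two_pos (hD2'.trans ?_)
      exact Real.self_le_rpow_of_one_le (by linarith) (by linarith)
    have hrs : 1 / (N : ℝ) ≤ (D : ℝ) ^ (-(1 + η)) := by
      rw [Real.rpow_neg hD0.le, one_div, ← hXN]
      exact inv_anti₀ (by positivity) (Real.rpow_le_rpow hD0.le hDX (by positivity))
    obtain ⟨T, hTcard, hT, hPT⟩ := exists_finset_floor_half hr hrs S rfl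
    have hcard := pow_le_card_of_not_isSingularDir hn hδ (by omega) hshalf
      (hN₀ D ((le_max_left _ _).trans hlarge)) (Set.iUnion₂_subset hS) hSv T hT hPT
    have hdiv : X / (2 * n) ≤ (D / n + 1 : ℕ) := by
      have h₁ : (D : ℝ) / n ≤ (D / n + 1 : ℕ) := by
        rw [div_le_iff₀ hn0]
        exact_mod_cast (Nat.lt_div_mul_add (a := D) hn).le.trans_eq (by ring)
      refine le_trans ?_ h₁
      rw [div_le_div_iff₀ (by positivity) hn0]
      nlinarith
    have hSX : (X / (4 * n)) ^ n ≤ S.card := by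
      have h₁ : ((D / n + 1 : ℕ) : ℝ) ^ n ≤ 2 ^ n * S.card := by
        exact_mod_cast hcard.trans hTcard
      have h₂ : (X / (2 * n)) ^ n ≤ 2 ^ n * S.card := le_trans (by gcongr) h₁
      have h₃ : X / (2 * n) = 2 * (X / (4 * n)) := by field_simp; norm_num
      rw [h₃, mul_pow] at h₂
      exact le_of_mul_le_mul_left h₂ (by positivity)
    have hXNη : (N : ℝ) ^ (-η) ≤ X / N := by
      rw [hX, div_eq_mul_inv, ← Real.rpow_neg_one (N : ℝ), ← Real.rpow_add hN0]
      refine Real.rpow_le_rpow_of_exponent_le hN1 ?_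
      have : (1 + η)⁻¹ + -1 = -(η / (1 + η)) := by field_simp; ring
      rw [this, neg_le_neg_iff]
      exact div_le_self hη.le (by linarith)
    calc min ((4 * n : ℝ)⁻¹ ^ n) (M₀⁻¹ ^ n) * (N : ℝ) ^ (-ε)
        ≤ (4 * n : ℝ)⁻¹ ^ n * ((N : ℝ) ^ (-η)) ^ n := by
          rw [← Real.rpow_mul_natCast hN0.le, show -η * n = -ε by rw [hη_def]; field_simp]
          gcongr
          exact min_le_left _ _
      _ ≤ (4 * n : ℝ)⁻¹ ^ n * (X / N) ^ n := by gcongr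
      _ = (X / (4 * n)) ^ n * (1 / N) ^ n := by
          rw [← mul_pow, ← mul_pow]
          congr 1
          field_simp
      _ ≤ S.card * (1 / N : ℝ) ^ n := by gcongr

/-- If every direction is singular, there is a small set with long intersections with lines in all
directions. -/
lemma exists_small_union_of_isSingularDir {n N : ℕ} (hn : 0 < n) {ε H : ℝ} (hε : 0 < ε)
    (hH : 0 < H) (hN : 5 ≤ N) (Q : MvPolynomial (Fin n) ℝ) (hQ : Q.totalDegree ≤ N)
    (hsing : ∀ v : EuclideanSpace ℝ (Fin n), ‖v‖ = 1 → IsSingularDir N ε H Q v) :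
    ∃ (M : ℕ) (S : Finset (Fin n → ℤ)), 0 < M ∧ (M : ℝ) ≤ (N : ℝ) ^ (1 + ε) ∧
      (∀ k ∈ S, gridCube n (1 / M) k ⊆ unitCube n) ∧
      (∀ v : EuclideanSpace ℝ (Fin n), ‖v‖ = 1 → ∃ x : EuclideanSpace ℝ (Fin n),
        ENNReal.ofReal (2 / H / 6 ^ n) ≤
          volume {t : ℝ | x + t • v ∈ ⋃ k ∈ S, gridCube n (1 / M) k}) ∧
      S.card * (1 / M : ℝ) ^ n ≤ 8 ^ n * (100 * n) * (N : ℝ) ^ (-ε) := by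
  classical
  have hN5 : (5 : ℝ) ≤ N := by exact_mod_cast hN
  have hN0 : (0 : ℝ) < N := by linarith
  set s : ℝ := (N : ℝ) ^ (-(1 + ε)) with hs_def
  have hs : 0 < s := Real.rpow_pos_of_pos hN0 _
  have hs_inv : (N : ℝ) ^ (1 + ε) = 1 / s := by
    rw [hs_def, Real.rpow_neg hN0.le, one_div, inv_inv]
  have hs_large : 5 ≤ 1 / s := by
    rw [← hs_inv]
    exact hN5.trans (Real.self_le_rpow_of_one_le (by linarith) (by linarith))
  have hs4 : s < 1 / 4 := by
    rw [le_div_iff₀ hs] at hs_large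
    linarith
  set M : ℕ := ⌊1 / s⌋₊ with hM_def
  have hMle : (M : ℝ) ≤ 1 / s := Nat.floor_le (by positivity)
  have hMlt : 1 / s < M + 1 := Nat.lt_floor_add_one _
  have hM1 : (1 : ℝ) < M := by linarith
  have hM0 : 0 < M := by
    have : (0 : ℝ) < M := by linarith
    exact_mod_cast this
  have hsM : s ≤ 1 / M := by
    rw [le_div_iff₀ (by linarith)]
    rw [le_div_iff₀ hs] at hMle
    linarith
  have hMs : (1 / M : ℝ) ≤ 2 * s := by
    rw [div_le_iff₀ (by linarith)]
    rw [div_lt_iff₀ hs] at hMlt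
    nlinarith
  have hfin : {k : Fin n → ℤ | gridCube n s k ⊆ unitCube n ∧
      RoughlyBisected Q (gridCube n s k)}.Finite :=
    (finite_gridCube_subset_unitCube hs).subset fun k hk => hk.1
  set T := hfin.toFinset with hT_def
  have hT : ∀ k ∈ T, gridCube n s k ⊆ unitCube n ∧ RoughlyBisected Q (gridCube n s k) :=
    fun k hk => hfin.mem_toFinset.1 hk
  have hTcard := card_roughlyBisected_le hs Q hQ T
    (fun k hk => index_nonneg_lt_of_gridCube_subset hs (hT k hk).1) (fun k hk => (hT k hk).2)
  obtain ⟨S, hScard, hS, hSv⟩ :=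
    exists_finset_gridCube_of_line hs hs4 hM0 hsM T fun k hk => (hT k hk).1
  refine ⟨M, S, hM0, hMle.trans_eq hs_inv.symm, hS, fun v hv => ?_, ?_⟩
  · obtain ⟨x, hx⟩ := hsing v hv
    set F := T.filter fun k => (gridCube n s k ∩ {y | ∃ t : ℝ, y = x + t • v}).Nonempty with hF
    have hFset : {k : Fin n → ℤ | gridCube n s k ⊆ unitCube n ∧
        RoughlyBisected Q (gridCube n s k) ∧
        (gridCube n s k ∩ {y | ∃ t : ℝ, y = x + t • v}).Nonempty} = F := by
      ext k
      simp [hF, hT_def, and_assoc]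
    rw [← hs_def, hFset, Set.ncard_coe_finset, hs_inv] at hx
    obtain ⟨x', hx'⟩ := hSv x v hv F (Finset.filter_subset _ _)
      fun k hk => (Finset.mem_filter.1 hk).2
    refine ⟨x', ?_⟩
    rw [ENNReal.ofReal_div_of_pos (by positivity)]
    refine ENNReal.div_le_of_le_mul' (le_trans (ENNReal.ofReal_le_ofReal ?_) (hx'.trans_eq ?_))
    · calc 2 / H = H⁻¹ * (1 / s) * (2 * s) := by field_simp
        _ ≤ F.card * (2 * s) := by gcongr
    · congr 1
      rw [← ENNReal.ofReal_natCast]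
      norm_num
  · have hTs : (T.card : ℝ) * s ^ n ≤ 100 * n * (N : ℝ) ^ (-ε) := by
      have hNs : N * s = (N : ℝ) ^ (-ε) := by
        rw [hs_def, ← Real.rpow_one_add' hN0.le (by linarith)]
        congr 1
        ring
      have hMs1 : M * s ≤ 1 := by rwa [le_div_iff₀ hs] at hMle
      obtain ⟨d, rfl⟩ : ∃ d, n = d + 1 := ⟨n - 1, by omega⟩
      calc (T.card : ℝ) * s ^ (d + 1)
          ≤ ((100 * ((d + 1) * (N * M ^ d)) : ℕ) : ℝ) * s ^ (d + 1) := by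
            gcongr
            exact hTcard
        _ = 100 * (d + 1 : ℕ) * (N * s) * (M * s) ^ d := by
            push_cast
            ring
        _ ≤ 100 * (d + 1 : ℕ) * (N * s) * 1 := by
            gcongr
            exact pow_le_one₀ (by positivity) hMs1
        _ = _ := by rw [hNs, mul_one]
    calc (S.card : ℝ) * (1 / M : ℝ) ^ n ≤ (4 ^ n * T.card : ℕ) * (2 * s) ^ n := by gcongr
      _ = 8 ^ n * (T.card * s ^ n) := by
          push_cast
          rw [mul_pow, show (8 : ℝ) = 4 * 2 by norm_num, mul_pow]
          ring
      _ ≤ 8 ^ n * (100 * n * (N : ℝ) ^ (-ε)) := by gcongr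
      _ = _ := by ring

end Equivalence

/-- The singular–direction conjecture is equivalent to a cube version of the Minkowski
Kakeya statement: (A) for all `ε, H > 0` and all sufficiently large `N`, no nonzero
polynomial of degree at most `N` has every direction `(N, ε, H)`-singular, if and only
if (B) every union `P` of `1/N`-grid cubes inside `[0,1]^n` that captures length `≥ δ`
of some line in every direction has volume at least `c · N^{-ε}`. -/
theorem singular_direction_conj_iff_cube_kakeya
    (n : ℕ) (hn : 2 ≤ n) :
    (∀ ε : ℝ, 0 < ε → ∀ H : ℝ, 0 < H → ∃ N₀ : ℕ, ∀ N : ℕ, N₀ ≤ N →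
      ∀ Q : MvPolynomial (Fin n) ℝ, Q ≠ 0 → Q.totalDegree ≤ N →
        ∃ v : EuclideanSpace ℝ (Fin n), ‖v‖ = 1 ∧ ¬ IsSingularDir N ε H Q v)
    ↔
    (∀ δ : ℝ, 0 < δ → ∀ ε : ℝ, 0 < ε → ∃ c : ℝ, 0 < c ∧
      ∀ N : ℕ, 0 < N →
        ∀ P : Set (EuclideanSpace ℝ (Fin n)),
          (∃ S : Set (Fin n → ℤ),
            (∀ k ∈ S, gridCube n (1 / N) k ⊆ unitCube n) ∧
            P = ⋃ k ∈ S, gridCube n (1 / N) k) →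
          (∀ v : EuclideanSpace ℝ (Fin n), ‖v‖ = 1 →
            ∃ x : EuclideanSpace ℝ (Fin n),
              ENNReal.ofReal δ ≤ volume {t : ℝ | x + t • v ∈ P}) →
          ENNReal.ofReal (c * (N : ℝ) ^ (-ε)) ≤ volume P) := by
  constructor
  · intro hA δ hδ ε hε
    obtain ⟨c, hc, hcN⟩ := volume_lower_bound_of_not_isSingularDir (by omega) hA hδ hε
    refine ⟨c, hc, fun N hN P hP hPv => ?_⟩
    obtain ⟨S, hS, rfl⟩ := hP
    have hN0 : (0 : ℝ) < 1 / N := by positivity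
    obtain ⟨S, rfl⟩ := ((finite_gridCube_subset_unitCube hN0).subset hS).exists_finset_coe
    simp only [Finset.mem_coe] at hS hPv ⊢
    refine (ENNReal.ofReal_le_ofReal (hcN N hN S hS hPv)).trans ?_
    refine (le_of_eq ?_).trans (card_mul_le_volume_biUnion_gridCube hN0 S)
    rw [ENNReal.ofReal_mul (by positivity), ENNReal.ofReal_natCast, ENNReal.ofReal_pow hN0.le]
  · intro hB ε hε H hH
    obtain ⟨c, hc, hcM⟩ := hB (2 / H / 6 ^ n) (by positivity) (ε / 2 / (1 + ε)) (by positivity)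
    have hlim : Filter.Tendsto (fun N : ℕ => c * (N : ℝ) ^ (ε / 2)) Filter.atTop Filter.atTop :=
      ((tendsto_rpow_atTop (by positivity)).comp tendsto_natCast_atTop_atTop).const_mul_atTop hc
    obtain ⟨N₀, hN₀⟩ := Filter.eventually_atTop.1
      ((hlim.eventually_gt_atTop (8 ^ n * (100 * n))).and (Filter.eventually_ge_atTop 5))
    refine ⟨N₀, fun N hN Q _ hQ => ?_⟩
    by_contra! hsing
    obtain ⟨hlarge, hN5⟩ := hN₀ N hN
    have hN0 : (0 : ℝ) < N := by
      have : 0 < N := by omega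
      exact_mod_cast this
    obtain ⟨M, S, hM, hMN, hS, hSv, hScard⟩ :=
      exists_small_union_of_isSingularDir (by omega) hε hH hN5 Q hQ hsing
    have hM0 : (0 : ℝ) < M := by exact_mod_cast hM
    have hlow := hcM M hM _ ⟨S, hS, by simp only [Finset.mem_coe]⟩ hSv
    have hupp := hlow.trans (volume_biUnion_gridCube_le _ S)
    rw [← ENNReal.ofReal_pow (by positivity), ← ENNReal.ofReal_natCast,
      ← ENNReal.ofReal_mul (by positivity), ENNReal.ofReal_le_ofReal_iff (by positivity)] at hupp
    have hpow : (N : ℝ) ^ (-(ε / 2)) ≤ (M : ℝ) ^ (-(ε / 2 / (1 + ε))) := by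
      calc (N : ℝ) ^ (-(ε / 2)) = ((N : ℝ) ^ (1 + ε)) ^ (-(ε / 2 / (1 + ε))) := by
            rw [← Real.rpow_mul hN0.le]
            congr 1
            field_simp
        _ ≤ _ := Real.rpow_le_rpow_of_nonpos hM0 hMN (neg_nonpos.2 (by positivity))
    have hfinal : c * (N : ℝ) ^ (-(ε / 2)) ≤ 8 ^ n * (100 * n) * (N : ℝ) ^ (-ε) :=
      (mul_le_mul_of_nonneg_left hpow hc.le).trans (hupp.trans hScard)
    have hmul := mul_le_mul_of_nonneg_right hfinal (Real.rpow_nonneg hN0.le ε)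
    rw [mul_assoc, mul_assoc, ← Real.rpow_add hN0, ← Real.rpow_add hN0, neg_add_cancel,
      Real.rpow_zero, mul_one, show -(ε / 2) + ε = ε / 2 by ring] at hmul
    exact absurd hlarge hmul.not_gt
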